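/- arXiv:1103.1237 — 2 statements merged into one kernel-verified Lean document; each statement's English description precedes it below -/
import Mathlib

section
/- Let N ≥ 2, 1 < p < N, and set p_* = N(p−1)/(N−p). Let f : ℝ → ℝ be continuous on (0,∞) with f(t) > 0 for all t > 0, and suppose liminf_{t→0⁺} t^{−p_*} f(t) > 0. Then for every R > 0 there is no function u which is positive on the exterior domain Ω = {x : ‖x‖ > R} and is a classical supersolution of −Δ_p u ≥ f(u) on Ω. -/
open MeasureTheory Filter Real Matrix
open scoped RealInnerProductSpace

/-- The vector field `F_p u (x) = ‖∇u(x)‖^(p-2) • ∇u(x)` (real power; equal to `0`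
when `∇u(x) = 0`). -/
noncomputable def pFlux (N : ℕ) (p : ℝ) (u : EuclideanSpace ℝ (Fin N) → ℝ)
    (x : EuclideanSpace ℝ (Fin N)) : EuclideanSpace ℝ (Fin N) :=
  ‖gradient u x‖ ^ (p - 2) • gradient u x

/-- The `p`-Laplacian `Δ_p u (x) = div (F_p u) (x)`. -/
noncomputable def pLaplacian (N : ℕ) (p : ℝ) (u : EuclideanSpace ℝ (Fin N) → ℝ)
    (x : EuclideanSpace ℝ (Fin N)) : ℝ :=
  ∑ i : Fin N, ⟪fderiv ℝ (pFlux N p u) x (EuclideanSpace.basisFun (Fin N) ℝ i),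
      EuclideanSpace.basisFun (Fin N) ℝ i⟫

/-- `u` is a classical supersolution of `-Δ_p u ≥ g` on `Ω`. -/
def IsPSupersolution (N : ℕ) (p : ℝ) (u : EuclideanSpace ℝ (Fin N) → ℝ)
    (g : EuclideanSpace ℝ (Fin N) → ℝ) (Ω : Set (EuclideanSpace ℝ (Fin N))) : Prop :=
  ContDiffOn ℝ 1 u Ω ∧ DifferentiableOn ℝ (pFlux N p u) Ω ∧
    ∀ x ∈ Ω, -pLaplacian N p u x ≥ g x

/-- The vector field `y ↦ ‖y‖^(p-2) • y`. -/
noncomputable def powField {E : Type*} [NormedAddCommGroup E] [InnerProductSpace ℝ E]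
    (p : ℝ) (y : E) : E :=
  ‖y‖ ^ (p - 2) • y

section PowField

variable {E : Type*} [NormedAddCommGroup E] [InnerProductSpace ℝ E]

lemma powField_zero (p : ℝ) : powField p (0 : E) = 0 := by simp [powField]

lemma norm_powField (p : ℝ) {y : E} (hy : y ≠ 0) : ‖powField p y‖ = ‖y‖ ^ (p - 1) := by
  have h : 0 < ‖y‖ := norm_pos_iff.2 hy
  rw [powField, norm_smul, Real.norm_of_nonneg (by positivity)]
  nth_rewrite 2 [← Real.rpow_one ‖y‖]
  rw [← Real.rpow_add h]
  ring_nf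

lemma powField_ne_zero (p : ℝ) {y : E} (hy : y ≠ 0) : powField p y ≠ 0 := by
  have h : 0 < ‖y‖ := norm_pos_iff.2 hy
  exact smul_ne_zero (by positivity) hy

lemma powField_smul_powField (p σ c : ℝ) {y : E} (hy : y ≠ 0) :
    powField p (c • powField σ y) =
      (|c| ^ (p - 2) * c) • powField ((σ - 1) * (p - 1) + 1) y := by
  have h : 0 < ‖y‖ := norm_pos_iff.2 hy
  have key : ‖y‖ ^ ((σ - 1) * (p - 2)) * ‖y‖ ^ (σ - 2) = ‖y‖ ^ ((σ - 1) * (p - 1) + 1 - 2) := by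
    rw [← Real.rpow_add h]
    ring_nf
  rw [powField, norm_smul, norm_powField σ hy, Real.norm_eq_abs,
    Real.mul_rpow (abs_nonneg c) (by positivity), ← Real.rpow_mul h.le]
  simp only [powField, smul_smul]
  rw [← key]
  ring_nf

lemma powField_conjExponent {p : ℝ} (hp : 1 < p) (y : E) :
    powField (p / (p - 1)) (powField p y) = y := by
  rcases eq_or_ne y 0 with rfl | hy
  · simp [powField_zero]
  have h := powField_smul_powField (p / (p - 1)) p 1 hy
  have hp' : p - 1 ≠ 0 := by linarith
  have e : (p - 1) * (p / (p - 1) - 1) + 1 = 2 := by field_simp; ring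
  rw [e] at h
  simpa [powField] using h

/-- The derivative of `powField p` away from the origin. -/
noncomputable def powFieldDeriv (p : ℝ) (y : E) : E →L[ℝ] E :=
  ‖y‖ ^ (p - 2) • ContinuousLinearMap.id ℝ E +
    ((p - 2) * ‖y‖ ^ (p - 4)) • (innerSL ℝ y).smulRight y

lemma hasFDerivAt_norm_rpow_of_ne (p : ℝ) {y : E} (hy : y ≠ 0) :
    HasFDerivAt (fun x : E => ‖x‖ ^ p) ((p * ‖y‖ ^ (p - 2)) • innerSL ℝ y) y := by
  have h : 0 < ‖y‖ := norm_pos_iff.2 hy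
  have h1 := ((hasStrictFDerivAt_norm_sq y).hasFDerivAt).rpow_const (p := p / 2)
    (Or.inl (by positivity))
  have h2 : (fun x : E => (‖x‖ ^ 2) ^ (p / 2)) = fun x : E => ‖x‖ ^ p := by
    ext x
    rw [← Real.rpow_natCast, ← Real.rpow_mul (norm_nonneg x)]
    congr 1
    push_cast
    ring
  rw [h2] at h1
  convert h1 using 1
  rw [← Real.rpow_natCast, ← Real.rpow_mul h.le, ← Nat.cast_smul_eq_nsmul ℝ, smul_smul]
  congr 1
  push_cast
  rw [show (2 : ℝ) * (p / 2 - 1) = p - 2 by ring]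
  ring

lemma hasFDerivAt_powField (p : ℝ) {y : E} (hy : y ≠ 0) :
    HasFDerivAt (powField p) (powFieldDeriv p y) y := by
  have h := (hasFDerivAt_norm_rpow_of_ne (p - 2) hy).smul (hasFDerivAt_id y)
  refine h.congr_fderiv ?_
  ext v
  simp only [powFieldDeriv, show p - 2 - 2 = p - 4 by ring]
  simp [smul_smul]

lemma hasGradientAt_mul_norm_rpow [CompleteSpace E] (b σ : ℝ) (z : E) {x : E}
    (hx : x ≠ z ∨ 1 < σ) :
    HasGradientAt (fun x : E => b * ‖x - z‖ ^ σ) ((b * σ) • powField σ (x - z)) x := by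
  have h : HasFDerivAt (fun x : E => ‖x‖ ^ σ) ((σ * ‖x - z‖ ^ (σ - 2)) • innerSL ℝ (x - z))
      (x - z) := by
    rcases hx with hx | hx
    · exact hasFDerivAt_norm_rpow_of_ne σ (sub_ne_zero.2 hx)
    · exact hasFDerivAt_norm_rpow _ hx
  rw [hasGradientAt_iff_hasFDerivAt]
  have h2 := (h.comp x ((hasFDerivAt_id x).sub_const z)).const_mul b
  refine h2.congr_fderiv ?_
  ext v
  simp [powField]
  ring

lemma trace_powFieldDeriv_comp [FiniteDimensional ℝ E] (p : ℝ) (y : E) (M : E →L[ℝ] E) :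
    LinearMap.trace ℝ E (powFieldDeriv p y ∘L M : E →L[ℝ] E) =
      ‖y‖ ^ (p - 2) * LinearMap.trace ℝ E M + (p - 2) * ‖y‖ ^ (p - 4) * ⟪y, M y⟫ := by
  set b := stdOrthonormalBasis ℝ E
  have hadj : ∑ i, ⟪y, M (b i)⟫ * ⟪b i, y⟫ = ⟪y, M y⟫ := by
    conv_rhs => rw [← b.sum_repr' y, map_sum, inner_sum]
    refine Finset.sum_congr rfl fun i _ => ?_
    rw [map_smul, inner_smul_right, b.sum_repr' y]
    ring
  rw [LinearMap.trace_eq_sum_inner _ b, LinearMap.trace_eq_sum_inner _ b, ← hadj, Finset.mul_sum,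
    Finset.mul_sum, ← Finset.sum_add_distrib]
  refine Finset.sum_congr rfl fun i _ => ?_
  simp [powFieldDeriv, inner_add_right, inner_smul_right]

lemma inner_map_self_le_norm_sq_mul_trace [FiniteDimensional ℝ E] (M : E →L[ℝ] E)
    (hM : ∀ e, 0 ≤ ⟪M e, e⟫) (y : E) :
    ⟪y, M y⟫ ≤ ‖y‖ ^ 2 * LinearMap.trace ℝ E M := by
  rcases eq_or_ne y 0 with rfl | hy
  · simp
  have h : 0 < ‖y‖ := norm_pos_iff.2 hy
  set e : E := ‖y‖⁻¹ • y with he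
  have hye : y = ‖y‖ • e := by rw [he, smul_smul, mul_inv_cancel₀ h.ne', one_smul]
  classical
  have hon : Orthonormal ℝ (Subtype.val : ({e} : Set E) → E) := by
    rw [orthonormal_subtype_iff_ite]
    rintro v rfl w rfl
    rw [if_pos rfl, real_inner_self_eq_norm_sq, he, norm_smul, norm_inv, norm_norm,
      inv_mul_cancel₀ h.ne', one_pow]
  obtain ⟨s, b, hs, hb⟩ := hon.exists_orthonormalBasis_extension
  have hes : e ∈ s := by simpa using hs rfl
  have h1 : ⟪e, M e⟫ ≤ LinearMap.trace ℝ E M := by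
    rw [LinearMap.trace_eq_sum_inner _ b]
    have := Finset.single_le_sum (f := fun i => ⟪b i, (M : E →ₗ[ℝ] E) (b i)⟫) (s := Finset.univ)
      (fun i _ => by rw [real_inner_comm]; exact hM _) (Finset.mem_univ ⟨e, hes⟩)
    simpa [hb] using this
  calc ⟪y, M y⟫ = ‖y‖ ^ 2 * ⟪e, M e⟫ := by
        conv_lhs => rw [hye, map_smul, inner_smul_left, inner_smul_right]
        simp; ring
    _ ≤ _ := by gcongr

lemma trace_powFieldDeriv_comp_nonneg [FiniteDimensional ℝ E] {p : ℝ} (hp : 1 < p) {y : E}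
    (hy : y ≠ 0) (M : E →L[ℝ] E) (hM : ∀ e, 0 ≤ ⟪M e, e⟫) :
    0 ≤ LinearMap.trace ℝ E (powFieldDeriv p y ∘L M : E →L[ℝ] E) := by
  have h : 0 < ‖y‖ := norm_pos_iff.2 hy
  have h1 := inner_map_self_le_norm_sq_mul_trace M hM y
  have h2 : 0 ≤ ⟪y, M y⟫ := by rw [real_inner_comm]; exact hM y
  have h3 : ‖y‖ ^ (p - 2) = ‖y‖ ^ (p - 4) * ‖y‖ ^ 2 := by
    rw [← Real.rpow_natCast, ← Real.rpow_add h]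
    push_cast
    ring_nf
  rw [trace_powFieldDeriv_comp, h3]
  have h4 : 0 ≤ ‖y‖ ^ (p - 4) := by positivity
  have : ‖y‖ ^ (p - 4) * ‖y‖ ^ 2 * LinearMap.trace ℝ E M + (p - 2) * ‖y‖ ^ (p - 4) * ⟪y, M y⟫ =
      ‖y‖ ^ (p - 4) * ((‖y‖ ^ 2 * LinearMap.trace ℝ E M - ⟪y, M y⟫) + (p - 1) * ⟪y, M y⟫) := by
    ring
  rw [this]
  exact mul_nonneg h4 (add_nonneg (by linarith) (mul_nonneg (by linarith) h2))

end PowField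

open scoped Topology

section LocalMin

variable {E : Type*} [NormedAddCommGroup E] [InnerProductSpace ℝ E]

lemma tendsto_add_smul_nhdsGT (x₀ e : E) :
    Tendsto (fun t : ℝ => x₀ + t • e) (𝓝[>] 0) (𝓝 x₀) := by
  have : Tendsto (fun t : ℝ => x₀ + t • e) (𝓝 0) (𝓝 (x₀ + (0 : ℝ) • e)) :=
    (Continuous.tendsto (by fun_prop) 0)
  rw [zero_smul, add_zero] at this
  exact this.mono_left nhdsWithin_le_nhds

lemma HasFDerivAt.tendsto_inv_smul {g : E → E} {M : E →L[ℝ] E} {x₀ : E} (hg : HasFDerivAt g M x₀)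
    (h0 : g x₀ = 0) (e : E) :
    Tendsto (fun t : ℝ => t⁻¹ • g (x₀ + t • e)) (𝓝[>] 0) (𝓝 (M e)) := by
  have h := (hg.hasLineDerivAt e).tendsto_slope_zero_right
  simpa [h0] using h

variable [CompleteSpace E]

lemma IsLocalMin.frequently_inner_gradient_nonneg {w : E → ℝ} {x₀ : E}
    (hw : ∀ᶠ x in 𝓝 x₀, DifferentiableAt ℝ w x) (hmin : IsLocalMin w x₀) (e : E) :
    ∃ᶠ t : ℝ in 𝓝[>] 0, 0 ≤ ⟪gradient w (x₀ + t • e), e⟫ := by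
  intro hcon
  have h1 := (tendsto_add_smul_nhdsGT x₀ e).eventually (hw.and hmin)
  obtain ⟨δ, hδ, hδ'⟩ := (mem_nhdsGT_iff_exists_Ioo_subset).1 (h1.and hcon)
  have hδ0 : (0 : ℝ) < δ := hδ
  have hderiv : ∀ t : ℝ, DifferentiableAt ℝ w (x₀ + t • e) →
      HasDerivAt (fun t : ℝ => w (x₀ + t • e)) ⟪gradient w (x₀ + t • e), e⟫ t := by
    intro t ht
    have h2 : HasDerivAt (fun t : ℝ => x₀ + t • e) e t := by
      simpa using ((hasDerivAt_id t).smul_const e).const_add x₀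
    have h3 := ht.hasGradientAt.hasFDerivAt.comp_hasDerivAt t h2
    rw [InnerProductSpace.toDual_apply_apply] at h3
    exact h3
  have hd0 : DifferentiableAt ℝ w (x₀ + (0 : ℝ) • e) := by simpa using hw.self_of_nhds
  obtain ⟨c, hc, hc'⟩ := exists_hasDerivAt_eq_slope (fun t : ℝ => w (x₀ + t • e))
    (fun t => ⟪gradient w (x₀ + t • e), e⟫) (half_pos hδ0) (by
      intro t ht
      rcases ht.1.eq_or_lt with rfl | h
      · exact (hderiv 0 hd0).continuousAt.continuousWithinAt
      · exact (hderiv t (hδ' ⟨h, by linarith [ht.2]⟩).1.1).continuousAt.continuousWithinAt)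
    (fun t ht => hderiv t (hδ' ⟨ht.1, by linarith [ht.2]⟩).1.1)
  have h3 := (hδ' (show c ∈ Set.Ioo 0 δ from ⟨hc.1, by linarith [hc.2]⟩)).2
  have h4 := (hδ' (show δ / 2 ∈ Set.Ioo 0 δ from ⟨by linarith, by linarith⟩)).1.2
  simp only [zero_smul, add_zero, sub_zero] at hc'
  apply h3
  rw [hc']
  exact div_nonneg (sub_nonneg.2 h4) (by linarith)

lemma IsLocalMin.inner_fderiv_gradient_nonneg {w : E → ℝ} {x₀ : E}
    (hw : ∀ᶠ x in 𝓝 x₀, DifferentiableAt ℝ w x) (hmin : IsLocalMin w x₀) {M : E →L[ℝ] E}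
    (hM : HasFDerivAt (gradient w) M x₀) (e : E) : 0 ≤ ⟪M e, e⟫ := by
  have h0 : gradient w x₀ = 0 := (LinearIsometryEquiv.map_eq_zero_iff _).1
    (hmin.hasFDerivAt_eq_zero hw.self_of_nhds.hasGradientAt.hasFDerivAt)
  have h1 := ((hM.tendsto_inv_smul h0 e).inner (tendsto_const_nhds (x := e)) (𝕜 := ℝ))
  refine ge_of_tendsto_of_frequently h1 ?_
  refine ((hmin.frequently_inner_gradient_nonneg hw e).and_eventually
    self_mem_nhdsWithin).mono ?_
  rintro t ⟨h2, h3⟩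
  rw [inner_smul_left]
  exact mul_nonneg (by simpa using (le_of_lt h3 : (0 : ℝ) ≤ t)) h2

end LocalMin

section PLaplacian

variable {N : ℕ} {p : ℝ}

lemma pLaplacian_eq_trace (u : EuclideanSpace ℝ (Fin N) → ℝ) (x : EuclideanSpace ℝ (Fin N)) :
    pLaplacian N p u x = LinearMap.trace ℝ _
      (fderiv ℝ (pFlux N p u) x : EuclideanSpace ℝ (Fin N) →ₗ[ℝ] EuclideanSpace ℝ (Fin N)) := by
  rw [LinearMap.trace_eq_sum_inner _ (EuclideanSpace.basisFun (Fin N) ℝ), pLaplacian]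
  exact Finset.sum_congr rfl fun i _ => real_inner_comm _ _

lemma gradient_eq_powField_pFlux (hp : 1 < p) (u : EuclideanSpace ℝ (Fin N) → ℝ) :
    gradient u = fun x => powField (p / (p - 1)) (pFlux N p u x) :=
  funext fun x => (powField_conjExponent hp (gradient u x)).symm

/-- The gradient inherits differentiability from the flux at noncritical points. -/
lemma differentiableAt_gradient (hp : 1 < p) {u : EuclideanSpace ℝ (Fin N) → ℝ}
    {x₀ : EuclideanSpace ℝ (Fin N)} (hF : DifferentiableAt ℝ (pFlux N p u) x₀)
    (h0 : gradient u x₀ ≠ 0) : DifferentiableAt ℝ (gradient u) x₀ := by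
  rw [gradient_eq_powField_pFlux hp]
  have h : DifferentiableAt ℝ (powField (p / (p - 1))) (pFlux N p u x₀) :=
    (hasFDerivAt_powField _ (powField_ne_zero p h0)).differentiableAt
  exact (h.hasFDerivAt.comp x₀ hF.hasFDerivAt).differentiableAt

lemma pLaplacian_eq_trace_comp {u : EuclideanSpace ℝ (Fin N) → ℝ}
    {x₀ : EuclideanSpace ℝ (Fin N)} (hd : DifferentiableAt ℝ (gradient u) x₀)
    (h0 : gradient u x₀ ≠ 0) :
    pLaplacian N p u x₀ = LinearMap.trace ℝ (EuclideanSpace ℝ (Fin N))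
      (powFieldDeriv p (gradient u x₀) ∘L fderiv ℝ (gradient u) x₀ :
        EuclideanSpace ℝ (Fin N) →L[ℝ] EuclideanSpace ℝ (Fin N)) := by
  rw [pLaplacian_eq_trace]
  congr 2
  exact ((hasFDerivAt_powField p h0).comp x₀ hd.hasFDerivAt).fderiv

/-- Pointwise comparison of `p`-Laplacians where one function touches another from below at a
noncritical point. -/
lemma pLaplacian_le_of_isLocalMin_sub (hp : 1 < p) {u v : EuclideanSpace ℝ (Fin N) → ℝ}
    {x₀ : EuclideanSpace ℝ (Fin N)} (hu : ∀ᶠ x in 𝓝 x₀, DifferentiableAt ℝ u x)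
    (hv : ∀ᶠ x in 𝓝 x₀, DifferentiableAt ℝ v x) (hF : DifferentiableAt ℝ (pFlux N p u) x₀)
    (hdv : DifferentiableAt ℝ (gradient v) x₀) (h0 : gradient v x₀ ≠ 0)
    (hmin : IsLocalMin (fun x => u x - v x) x₀) :
    pLaplacian N p v x₀ ≤ pLaplacian N p u x₀ := by
  have hgrad : ∀ x, DifferentiableAt ℝ u x → DifferentiableAt ℝ v x →
      HasGradientAt (fun x => u x - v x) (gradient u x - gradient v x) x := by
    intro x h1 h2
    rw [hasGradientAt_iff_hasFDerivAt, map_sub]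
    exact h1.hasGradientAt.hasFDerivAt.sub h2.hasGradientAt.hasFDerivAt
  have heq : gradient u x₀ = gradient v x₀ := sub_eq_zero.1 <|
    (LinearIsometryEquiv.map_eq_zero_iff _).1 <| hmin.hasFDerivAt_eq_zero
      (hgrad x₀ hu.self_of_nhds hv.self_of_nhds).hasFDerivAt
  have hdu := differentiableAt_gradient hp hF (heq ▸ h0)
  have hw : ∀ᶠ x in 𝓝 x₀, DifferentiableAt ℝ (fun x => u x - v x) x := by
    filter_upwards [hu, hv] with x h1 h2 using h1.sub h2
  have hM : HasFDerivAt (gradient fun x => u x - v x)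
      (fderiv ℝ (gradient u) x₀ - fderiv ℝ (gradient v) x₀) x₀ := by
    refine (hdu.hasFDerivAt.sub hdv.hasFDerivAt).congr_of_eventuallyEq ?_
    filter_upwards [hu, hv] with x h1 h2 using (hgrad x h1 h2).gradient
  have := trace_powFieldDeriv_comp_nonneg hp h0 _ (hmin.inner_fderiv_gradient_nonneg hw hM)
  rw [ContinuousLinearMap.comp_sub, ContinuousLinearMap.toLinearMap_sub, map_sub] at this
  rw [pLaplacian_eq_trace_comp hdu (heq ▸ h0), pLaplacian_eq_trace_comp hdv h0, heq]
  linarith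

lemma trace_powFieldDeriv (τ : ℝ) {y : EuclideanSpace ℝ (Fin N)} (hy : y ≠ 0) :
    LinearMap.trace ℝ (EuclideanSpace ℝ (Fin N)) (powFieldDeriv τ y) =
      (N + τ - 2) * ‖y‖ ^ (τ - 2) := by
  have h : 0 < ‖y‖ := norm_pos_iff.2 hy
  have h1 := trace_powFieldDeriv_comp τ y (ContinuousLinearMap.id ℝ _)
  rw [ContinuousLinearMap.comp_id] at h1
  have h2 : ‖y‖ ^ (τ - 2) = ‖y‖ ^ (τ - 4) * ‖y‖ ^ 2 := by
    rw [← Real.rpow_natCast, ← Real.rpow_add h]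
    push_cast
    ring_nf
  rw [h1, ContinuousLinearMap.coe_id, LinearMap.trace_id]
  simp only [ContinuousLinearMap.id_apply, real_inner_self_eq_norm_sq, finrank_euclideanSpace,
    Fintype.card_fin]
  rw [h2]
  ring

/-- The `p`-Laplacian of a radial power. -/
lemma pLaplacian_mul_norm_rpow (a b σ : ℝ) (z : EuclideanSpace ℝ (Fin N))
    {x : EuclideanSpace ℝ (Fin N)} (hx : x ≠ z) :
    pLaplacian N p (fun x => a + b * ‖x - z‖ ^ σ) x =
      |b * σ| ^ (p - 2) * (b * σ) *
        ((N + (σ - 1) * (p - 1) - 1) * ‖x - z‖ ^ ((σ - 1) * (p - 1) - 1)) := by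
  have hxz : x - z ≠ 0 := sub_ne_zero.2 hx
  set τ := (σ - 1) * (p - 1) + 1 with hτ
  have h1 : pFlux N p (fun x => a + b * ‖x - z‖ ^ σ) =ᶠ[𝓝 x]
      fun x => (|b * σ| ^ (p - 2) * (b * σ)) • powField τ (x - z) := by
    filter_upwards [eventually_ne_nhds hx] with y hy
    have : gradient (fun x => a + b * ‖x - z‖ ^ σ) y = (b * σ) • powField σ (y - z) := by
      refine HasGradientAt.gradient ?_
      rw [hasGradientAt_iff_hasFDerivAt]
      exact (hasGradientAt_mul_norm_rpow b σ z (Or.inl hy)).hasFDerivAt.const_add a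
    rw [← powField_smul_powField p σ (b * σ) (sub_ne_zero.2 hy), ← this]
    rfl
  have h2 : HasFDerivAt (fun x => (|b * σ| ^ (p - 2) * (b * σ)) • powField τ (x - z))
      ((|b * σ| ^ (p - 2) * (b * σ)) • powFieldDeriv τ (x - z)) x := by
    have := (hasFDerivAt_powField τ hxz).comp x ((hasFDerivAt_id x).sub_const z)
    exact this.const_smul (|b * σ| ^ (p - 2) * (b * σ))
  rw [pLaplacian_eq_trace, (h2.congr_of_eventuallyEq h1).fderiv,
    ContinuousLinearMap.toLinearMap_smul, map_smul, trace_powFieldDeriv _ hxz, smul_eq_mul, hτ]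
  ring_nf

/-- A radial power touching `u` from below at a point other than its centre bounds the
`p`-Laplacian of `u` from below. -/
lemma le_pLaplacian_of_isLocalMin_sub_norm_rpow (hp : 1 < p) {u : EuclideanSpace ℝ (Fin N) → ℝ}
    {x₀ z : EuclideanSpace ℝ (Fin N)} (hx₀ : x₀ ≠ z)
    (hu : ∀ᶠ x in 𝓝 x₀, DifferentiableAt ℝ u x) (hF : DifferentiableAt ℝ (pFlux N p u) x₀)
    {a b σ : ℝ} (hb : b ≠ 0) (hσ : σ ≠ 0)
    (hmin : IsLocalMin (fun x => u x - (a + b * ‖x - z‖ ^ σ)) x₀) :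
    |b * σ| ^ (p - 2) * (b * σ) *
        ((N + (σ - 1) * (p - 1) - 1) * ‖x₀ - z‖ ^ ((σ - 1) * (p - 1) - 1)) ≤
      pLaplacian N p u x₀ := by
  have hxz : x₀ - z ≠ 0 := sub_ne_zero.2 hx₀
  have hg : ∀ y, y ≠ z → HasGradientAt (fun x => a + b * ‖x - z‖ ^ σ)
      ((b * σ) • powField σ (y - z)) y := by
    intro y hy
    rw [hasGradientAt_iff_hasFDerivAt]
    exact (hasGradientAt_mul_norm_rpow b σ z (Or.inl hy)).hasFDerivAt.const_add a
  rw [← pLaplacian_mul_norm_rpow a b σ z hx₀]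
  refine pLaplacian_le_of_isLocalMin_sub hp hu ?_ hF ?_ ?_ hmin
  · filter_upwards [eventually_ne_nhds hx₀] with y hy using (hg y hy).differentiableAt
  · have h1 : gradient (fun x => a + b * ‖x - z‖ ^ σ) =ᶠ[𝓝 x₀]
        fun y => (b * σ) • powField σ (y - z) := by
      filter_upwards [eventually_ne_nhds hx₀] with y hy using (hg y hy).gradient
    refine DifferentiableAt.congr_of_eventuallyEq ?_ h1
    have := (hasFDerivAt_powField σ hxz).comp x₀ ((hasFDerivAt_id x₀).sub_const z)
    exact (this.const_smul (b * σ)).differentiableAt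
  · rw [(hg x₀ hx₀).gradient]
    exact smul_ne_zero (mul_ne_zero hb hσ) (powField_ne_zero σ hxz)


/-- A function touched from below at a critical point by a power `-A ‖x - z‖ ^ β` of exponent
larger than `p / (p - 1)` is not strictly `p`-superharmonic there. -/
lemma pLaplacian_nonneg_of_isLocalMin_add_norm_rpow (hp : 1 < p)
    {u : EuclideanSpace ℝ (Fin N) → ℝ} {z : EuclideanSpace ℝ (Fin N)}
    (hu : ∀ᶠ x in 𝓝 z, DifferentiableAt ℝ u x) (hF : DifferentiableAt ℝ (pFlux N p u) z)
    {A β : ℝ} (hβ : p / (p - 1) < β)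
    (hmin : IsLocalMin (fun x => u x + A * ‖x - z‖ ^ β) z) :
    0 ≤ pLaplacian N p u z := by
  have hp1 : 0 < p - 1 := by linarith
  have hp' : 1 < p / (p - 1) := by rw [lt_div_iff₀ hp1]; linarith
  have hβ1 : 1 < β := hp'.trans hβ
  have hgrad : ∀ x, DifferentiableAt ℝ u x → HasGradientAt (fun x => u x + A * ‖x - z‖ ^ β)
      (gradient u x + (A * β) • powField β (x - z)) x := by
    intro x h1
    rw [hasGradientAt_iff_hasFDerivAt, map_add]
    exact h1.hasGradientAt.hasFDerivAt.add
      (hasGradientAt_mul_norm_rpow A β z (Or.inr hβ1)).hasFDerivAt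
  have hg0 : gradient u z = 0 := by
    have h1 := (LinearIsometryEquiv.map_eq_zero_iff _).1
      (hmin.hasFDerivAt_eq_zero (hgrad z hu.self_of_nhds).hasFDerivAt)
    simpa [powField_zero] using h1
  have hF0 : pFlux N p u z = 0 := by simp [pFlux, hg0]
  by_contra! hcon
  obtain ⟨i, -, hi⟩ := Finset.exists_lt_of_sum_lt (s := Finset.univ)
    (hcon.trans_eq Finset.sum_const_zero.symm)
  set e := EuclideanSpace.basisFun (Fin N) ℝ i with he
  set L := fderiv ℝ (pFlux N p u) z with hL
  set κ := -⟪L e, e⟫ / 2 with hκ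
  have hκ0 : 0 < κ := by linarith
  set C := ‖L e‖ + 1 with hC
  have hC0 : 0 < C := by positivity
  have ht := hF.hasFDerivAt.tendsto_inv_smul hF0 e
  have ev1 : ∀ᶠ t : ℝ in 𝓝[>] 0, ⟪pFlux N p u (z + t • e), e⟫ < -(κ * t) := by
    have h1 := ht.inner (tendsto_const_nhds (x := e)) (𝕜 := ℝ)
    filter_upwards [h1.eventually (eventually_lt_nhds (show ⟪L e, e⟫ < -κ by linarith)),
      self_mem_nhdsWithin] with t h2 h3
    have h3 : 0 < t := h3
    rw [real_inner_smul_left, inv_mul_lt_iff₀ h3] at h2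
    linarith
  have ev2 : ∀ᶠ t : ℝ in 𝓝[>] 0, ‖pFlux N p u (z + t • e)‖ < C * t := by
    filter_upwards [ht.norm.eventually (eventually_lt_nhds (show ‖L e‖ < C by linarith)),
      self_mem_nhdsWithin] with t h2 h3
    have h3 : 0 < t := h3
    rw [norm_smul, norm_inv, Real.norm_of_nonneg h3.le, inv_mul_lt_iff₀ h3] at h2
    linarith
  set p' := p / (p - 1) with hp'def
  set c := κ / C * κ ^ (p' - 1) with hc
  have hc0 : 0 < c := by positivity
  have ev3 : ∀ᶠ t : ℝ in 𝓝[>] 0, A * β * t ^ (β - p') < c := by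
    have h1 : Tendsto (fun t : ℝ => A * β * t ^ (β - p')) (𝓝 0) (𝓝 (A * β * 0 ^ (β - p'))) :=
      ((Real.continuousAt_rpow_const 0 _ (Or.inr (by linarith))).tendsto).const_mul _
    rw [Real.zero_rpow (by linarith), mul_zero] at h1
    exact (h1.mono_left nhdsWithin_le_nhds).eventually (eventually_lt_nhds hc0)
  have ev4 := (tendsto_add_smul_nhdsGT z e).eventually hu
  have hw : ∀ᶠ x in 𝓝 z, DifferentiableAt ℝ (fun x => u x + A * ‖x - z‖ ^ β) x := by
    filter_upwards [hu] with x h1 using (hgrad x h1).differentiableAt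
  have hfreq := hmin.frequently_inner_gradient_nonneg hw e
  obtain ⟨t, h0, h1, h2, h3, h4, h5⟩ := (hfreq.and_eventually (ev1.and (ev2.and (ev3.and
    (ev4.and self_mem_nhdsWithin))))).exists
  have ht0 : 0 < t := h5
  have hne : ‖e‖ = 1 := (EuclideanSpace.basisFun (Fin N) ℝ).orthonormal.1 i
  rw [(hgrad _ h4).gradient, inner_add_left, real_inner_smul_left, add_sub_cancel_left,
    powField, real_inner_smul_left, real_inner_smul_left, real_inner_self_eq_norm_sq, norm_smul,
    hne, Real.norm_of_nonneg ht0.le] at h0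
  set F := pFlux N p u (z + t • e) with hFdef
  have hgF : ⟪gradient u (z + t • e), e⟫ = ‖F‖ ^ (p' - 2) * ⟪F, e⟫ := by
    rw [← real_inner_smul_left]
    exact congrArg (fun y => ⟪y, e⟫) (congrFun (gradient_eq_powField_pFlux hp u) (z + t • e))
  rw [hgF] at h0
  have hFlow : κ * t < ‖F‖ := by
    have := (abs_real_inner_le_norm F e)
    rw [hne, mul_one] at this
    linarith [neg_abs_le ⟪F, e⟫]
  have hFpos : 0 < ‖F‖ := (by positivity : 0 < κ * t).trans hFlow
  have h6 : ‖F‖ ^ (p' - 2) = ‖F‖ ^ (p' - 1) / ‖F‖ := by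
    rw [← Real.rpow_sub_one hFpos.ne']; ring_nf
  have h7 : (κ * t) ^ (p' - 1) / (C * t) ≤ ‖F‖ ^ (p' - 2) := by
    rw [h6]
    have : (κ * t) ^ (p' - 1) ≤ ‖F‖ ^ (p' - 1) :=
      Real.rpow_le_rpow (by positivity) hFlow.le (by linarith)
    gcongr
  have h8 : (κ * t) ^ (p' - 1) / (C * t) * (κ * t) = c * t ^ (p' - 1) := by
    rw [hc, Real.mul_rpow hκ0.le ht0.le]
    field_simp
  have h9 : (κ * t) ^ (p' - 1) / (C * t) * (κ * t) ≤ ‖F‖ ^ (p' - 2) * -⟪F, e⟫ := by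
    gcongr
    linarith
  have h10 : t ^ (β - 2) * (t * 1 ^ 2) = t ^ (β - p') * t ^ (p' - 1) := by
    rw [one_pow, mul_one, ← Real.rpow_add ht0, ← Real.rpow_add_one ht0.ne']
    ring_nf
  have h11 : A * β * t ^ (β - p') * t ^ (p' - 1) < c * t ^ (p' - 1) := by gcongr
  have h12 : A * β * (t ^ (β - 2) * (t * 1 ^ 2)) < c * t ^ (p' - 1) := by
    rw [h10]; linarith
  simp only [one_pow, mul_one] at h12 h0
  linarith

end PLaplacian

section Supersolution

variable {N : ℕ} {p R : ℝ} {u g : EuclideanSpace ℝ (Fin N) → ℝ}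
  {Ω : Set (EuclideanSpace ℝ (Fin N))}

lemma isOpen_norm_gt : IsOpen {x : EuclideanSpace ℝ (Fin N) | R < ‖x‖} :=
  isOpen_lt continuous_const continuous_norm

lemma IsPSupersolution.eventually_differentiableAt (hu : IsPSupersolution N p u g Ω)
    (hΩ : IsOpen Ω) {x : EuclideanSpace ℝ (Fin N)} (hx : x ∈ Ω) :
    ∀ᶠ y in 𝓝 x, DifferentiableAt ℝ u y := by
  filter_upwards [hΩ.mem_nhds hx] with y hy
  exact (hu.1.differentiableOn one_ne_zero).differentiableAt (hΩ.mem_nhds hy)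

lemma rpow_sub_two_mul_self_of_neg {c : ℝ} (hc : c < 0) : |c| ^ (p - 2) * c = -|c| ^ (p - 1) := by
  have h : 0 < |c| := abs_pos.2 hc.ne
  have : |c| ^ (p - 1) = |c| ^ (p - 2) * |c| := by
    rw [← Real.rpow_add_one h.ne']; ring_nf
  rw [this, abs_of_neg hc]
  ring

/-- Around every point of the domain of a positive supersolution there is a point of lower height
where the right-hand side is controlled. -/
lemma IsPSupersolution.exists_mem_ball_le (hp : 1 < p) (hu : IsPSupersolution N p u g Ω)
    (hΩ : IsOpen Ω) (hg : ∀ x ∈ Ω, 0 < g x) {z : EuclideanSpace ℝ (Fin N)} {ρ : ℝ}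
    (hρ : 0 < ρ) (hball : Metric.closedBall z ρ ⊆ Ω) (hpos : ∀ x ∈ Metric.closedBall z ρ, 0 < u x) :
    ∃ x ∈ Metric.ball z ρ, u x ≤ u z ∧
      g x ≤ (u z * (p / (p - 1) + 1)) ^ (p - 1) * (N + p - 1) * ρ ^ (-p) := by
  have hp1 : 0 < p - 1 := by linarith
  have hp' : 1 < p / (p - 1) := by rw [lt_div_iff₀ hp1]; linarith
  set β := p / (p - 1) + 1 with hβ
  have hβ0 : 0 < β := by linarith
  have hz : z ∈ Metric.closedBall z ρ := Metric.mem_closedBall_self hρ.le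
  have huz := hpos z hz
  set A := u z * ρ ^ (-β) with hA
  have hA0 : 0 < A := by positivity
  have hcont : ContinuousOn (fun x => u x + A * ‖x - z‖ ^ β) (Metric.closedBall z ρ) := by
    refine (hu.1.continuousOn.mono hball).add (Continuous.continuousOn ?_)
    exact continuous_const.mul
      ((by fun_prop : Continuous fun x => ‖x - z‖).rpow_const fun _ => Or.inr hβ0.le)
  obtain ⟨x, hx, hmin⟩ := (isCompact_closedBall z ρ).exists_isMinOn ⟨z, hz⟩ hcont
  have hxz : u x + A * ‖x - z‖ ^ β ≤ u z := by
    have := hmin hz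
    simpa [Real.zero_rpow hβ0.ne'] using this
  have hux := hpos x hx
  have hball' : x ∈ Metric.ball z ρ := by
    rcases (Metric.mem_closedBall.1 hx).eq_or_lt with h | h
    · rw [dist_eq_norm] at h
      rw [h, hA, mul_assoc, ← Real.rpow_add hρ, neg_add_cancel, Real.rpow_zero, mul_one] at hxz
      linarith
    · exact h
  have hA1 : 0 ≤ A * ‖x - z‖ ^ β := by positivity
  refine ⟨x, hball', by linarith, ?_⟩
  have hloc : IsLocalMin (fun x => u x + A * ‖x - z‖ ^ β) x :=
    hmin.isLocalMin (Filter.mem_of_superset (Metric.isOpen_ball.mem_nhds hball')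
      Metric.ball_subset_closedBall)
  have hd := hu.eventually_differentiableAt hΩ (hball hx)
  have hFd := hu.2.1.differentiableAt (hΩ.mem_nhds (hball hx))
  have hsup := hu.2.2 x (hball hx)
  have hgx := hg x (hball hx)
  rcases eq_or_ne x z with rfl | hne
  · have := pLaplacian_nonneg_of_isLocalMin_add_norm_rpow hp hd hFd (by linarith : p / (p - 1) < β)
      hloc
    linarith
  have hloc' : IsLocalMin (fun x => u x - (0 + -A * ‖x - z‖ ^ β)) x := by
    convert hloc using 2
    ring
  have key := le_pLaplacian_of_isLocalMin_sub_norm_rpow hp hne hd hFd (by linarith : -A ≠ 0)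
    hβ0.ne' hloc'
  have hneg : -A * β < 0 := by nlinarith
  rw [rpow_sub_two_mul_self_of_neg hneg, abs_of_neg hneg,
    show -(-A * β) = A * β by ring] at key
  have e1 : (β - 1) * (p - 1) = p := by rw [hβ]; field_simp; ring
  rw [e1] at key
  have e2 : ‖x - z‖ ^ (p - 1) ≤ ρ ^ (p - 1) :=
    Real.rpow_le_rpow (norm_nonneg _) (by simpa [dist_eq_norm] using hx) hp1.le
  have e3 : (A * β) ^ (p - 1) = (u z * β) ^ (p - 1) * (ρ ^ (-p) * ρ ^ (-(p - 1))) := by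
    rw [hA, show u z * ρ ^ (-β) * β = (u z * β) * ρ ^ (-β) by ring,
      Real.mul_rpow (by positivity) (by positivity), ← Real.rpow_mul hρ.le, ← Real.rpow_add hρ]
    congr 2
    linarith
  have e4 : ρ ^ (-(p - 1)) * ρ ^ (p - 1) = 1 := by
    rw [← Real.rpow_add hρ, neg_add_cancel, Real.rpow_zero]
  have hN0 : (0 : ℝ) ≤ N + p - 1 := by have := Nat.cast_nonneg (α := ℝ) N; linarith
  calc g x ≤ (A * β) ^ (p - 1) * ((N + p - 1) * ‖x - z‖ ^ (p - 1)) := by linarith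
    _ ≤ (A * β) ^ (p - 1) * ((N + p - 1) * ρ ^ (p - 1)) := by gcongr
    _ = (u z * β) ^ (p - 1) * (N + p - 1) * ρ ^ (-p) * (ρ ^ (-(p - 1)) * ρ ^ (p - 1)) := by
        rw [e3]; ring
    _ = _ := by rw [e4, mul_one]

/-- Comparison of a supersolution with a radial power in an annulus. -/
lemma IsPSupersolution.le_of_mem_annulus (hp : 1 < p)
    (hu : IsPSupersolution N p u g {x | R < ‖x‖}) {r₁ r₂ a b σ : ℝ} (hr₁ : R < r₁) (hr₀ : 0 < r₁)
    (hb : b ≠ 0) (hσ : σ ≠ 0)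
    (h₁ : ∀ x : EuclideanSpace ℝ (Fin N), ‖x‖ = r₁ → a + b * r₁ ^ σ ≤ u x)
    (h₂ : ∀ x : EuclideanSpace ℝ (Fin N), ‖x‖ = r₂ → a + b * r₂ ^ σ ≤ u x)
    (hlt : ∀ x : EuclideanSpace ℝ (Fin N), r₁ < ‖x‖ → ‖x‖ < r₂ → u x < a + b * ‖x‖ ^ σ →
      -(|b * σ| ^ (p - 2) * (b * σ) *
        ((N + (σ - 1) * (p - 1) - 1) * ‖x‖ ^ ((σ - 1) * (p - 1) - 1))) < g x)
    {x : EuclideanSpace ℝ (Fin N)} (hx₁ : r₁ ≤ ‖x‖) (hx₂ : ‖x‖ ≤ r₂) :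
    a + b * ‖x‖ ^ σ ≤ u x := by
  set K : Set (EuclideanSpace ℝ (Fin N)) := {x | r₁ ≤ ‖x‖} ∩ Metric.closedBall 0 r₂ with hK
  have hKc : IsCompact K :=
    (isCompact_closedBall 0 r₂).inter_left (isClosed_le continuous_const continuous_norm)
  have hcont : ContinuousOn (fun x => u x - (a + b * ‖x‖ ^ σ)) K := by
    refine (hu.1.continuousOn.mono fun y hy => hr₁.trans_le hy.1).sub (continuousOn_const.add
      (continuousOn_const.mul (continuous_norm.continuousOn.rpow_const fun y hy => Or.inl ?_)))
    exact (hr₀.trans_le hy.1).ne'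
  have hxK : x ∈ K := ⟨hx₁, by simpa using hx₂⟩
  obtain ⟨y, hy, hmin⟩ := hKc.exists_isMinOn ⟨x, hxK⟩ hcont
  by_contra! hcon
  have hyx : u y - (a + b * ‖y‖ ^ σ) ≤ u x - (a + b * ‖x‖ ^ σ) := hmin hxK
  have hy₁ : r₁ < ‖y‖ := lt_of_le_of_ne hy.1 fun h => by
    have := h₁ y h.symm
    rw [← h] at hyx
    linarith
  have hy₂ : ‖y‖ < r₂ := lt_of_le_of_ne (by simpa using hy.2) fun h => by
    have := h₂ y h
    rw [h] at hyx
    linarith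
  have hloc : IsLocalMin (fun x => u x - (a + b * ‖x - 0‖ ^ σ)) y := by
    simp only [sub_zero]
    refine hmin.isLocalMin ?_
    filter_upwards [(isOpen_lt continuous_const continuous_norm).mem_nhds hy₁,
      (isOpen_lt continuous_norm continuous_const).mem_nhds hy₂] with w h1 h2
    exact ⟨le_of_lt h1, by simpa using le_of_lt h2⟩
  have hyR : R < ‖y‖ := hr₁.trans hy₁
  have key := le_pLaplacian_of_isLocalMin_sub_norm_rpow hp
    (norm_pos_iff.1 (hr₀.trans hy₁)) (hu.eventually_differentiableAt isOpen_norm_gt hyR)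
    (hu.2.1.differentiableAt (isOpen_norm_gt.mem_nhds hyR)) hb hσ hloc
  have h1 := hlt y hy₁ hy₂ (by linarith)
  have h2 := hu.2.2 y hyR
  rw [sub_zero] at key
  linarith

/-- The infimum of `u` over the sphere of radius `r` centred at the origin. -/
noncomputable def sphereMin (u : EuclideanSpace ℝ (Fin N) → ℝ) (r : ℝ) : ℝ :=
  sInf (u '' Metric.sphere 0 r)

lemma IsPSupersolution.isLeast_sphereMin (hN : 0 < N)
    (hu : IsPSupersolution N p u g {x | R < ‖x‖}) {r : ℝ} (hr : R < r) (hr₀ : 0 < r) :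
    IsLeast (u '' Metric.sphere 0 r) (sphereMin u r) := by
  have : Nonempty (Fin N) := ⟨⟨0, hN⟩⟩
  refine IsCompact.isLeast_sInf ?_ ((NormedSpace.sphere_nonempty.2 hr₀.le).image u)
  refine (isCompact_sphere 0 r).image_of_continuousOn (hu.1.continuousOn.mono fun x hx => ?_)
  rw [mem_sphere_zero_iff_norm] at hx
  rwa [Set.mem_ofPred_eq, hx]

lemma IsPSupersolution.sphereMin_le (hN : 0 < N)
    (hu : IsPSupersolution N p u g {x | R < ‖x‖}) (hR : 0 < R) {x : EuclideanSpace ℝ (Fin N)}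
    (hx : R < ‖x‖) : sphereMin u ‖x‖ ≤ u x :=
  (hu.isLeast_sphereMin hN hx (hR.trans hx)).2 ⟨x, by simp, rfl⟩

lemma IsPSupersolution.exists_eq_sphereMin (hN : 0 < N)
    (hu : IsPSupersolution N p u g {x | R < ‖x‖}) (hR : 0 < R) {r : ℝ} (hr : R < r) :
    ∃ x, ‖x‖ = r ∧ u x = sphereMin u r := by
  obtain ⟨x, hx, hx'⟩ := (hu.isLeast_sphereMin hN hr (hR.trans hr)).1
  exact ⟨x, by simpa using hx, hx'⟩

lemma IsPSupersolution.sphereMin_pos (hN : 0 < N)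
    (hu : IsPSupersolution N p u g {x | R < ‖x‖}) (hR : 0 < R) (hpos : ∀ x, R < ‖x‖ → 0 < u x)
    {r : ℝ} (hr : R < r) : 0 < sphereMin u r := by
  obtain ⟨x, hx, hx'⟩ := hu.exists_eq_sphereMin hN hR hr
  exact hx' ▸ hpos x (hx ▸ hr)

lemma IsPSupersolution.one_sub_rpow_mul_sphereMin_le (hp : 1 < p) (hpN : p < N)
    (hu : IsPSupersolution N p u g {x | R < ‖x‖}) (hR : 0 < R) (hpos : ∀ x, R < ‖x‖ → 0 < u x)
    (hg : ∀ x, R < ‖x‖ → 0 < g x) {r₀ r : ℝ} (hr₀ : R < r₀) {x : EuclideanSpace ℝ (Fin N)}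
    (hx : r₀ ≤ ‖x‖) (hr : ‖x‖ ≤ r) :
    (1 - (r₀ / ‖x‖) ^ ((N - p) / (p - 1))) * sphereMin u r ≤ u x := by
  have hN : 0 < N := by exact_mod_cast (by linarith : (0 : ℝ) < N)
  have hp1 : 0 < p - 1 := by linarith
  set γ := (N - p) / (p - 1) with hγ
  have hγ0 : 0 < γ := div_pos (by linarith) hp1
  have h0 : 0 < r₀ := hR.trans hr₀
  have hx0 : 0 < ‖x‖ := h0.trans_le hx
  have hm := hu.sphereMin_pos hN hR hpos (hr₀.trans_le (hx.trans hr))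
  set m := sphereMin u r
  have hb : 0 < m * r₀ ^ γ := by positivity
  have key := hu.le_of_mem_annulus hp (a := m) (b := -(m * r₀ ^ γ)) (σ := -γ) (r₂ := r) hr₀ h0
    (by linarith) (by linarith) ?_ ?_ ?_ hx hr
  · refine le_trans (le_of_eq ?_) key
    rw [Real.div_rpow h0.le hx0.le, Real.rpow_neg hx0.le]
    ring
  · intro y hy
    have : m + -(m * r₀ ^ γ) * r₀ ^ (-γ) = 0 := by
      rw [Real.rpow_neg h0.le]; field_simp; ring
    rw [this]
    exact (hpos y (hy ▸ hr₀)).le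
  · intro y hy
    have h1 : m ≤ u y := by
      have := hu.sphereMin_le hN hR (x := y) (by rw [hy]; linarith)
      rwa [hy] at this
    have h2 : 0 ≤ m * r₀ ^ γ * r ^ (-γ) := mul_nonneg hb.le (Real.rpow_nonneg (by linarith) _)
    linarith
  · intro y hy _ _
    have : (N : ℝ) + (-γ - 1) * (p - 1) - 1 = 0 := by rw [hγ]; field_simp; ring
    rw [this]
    simpa using hg y (hr₀.trans hy)

lemma IsPSupersolution.sphereMin_mul_rpow_le (hp : 1 < p) (hpN : p < N)
    (hu : IsPSupersolution N p u g {x | R < ‖x‖}) (hR : 0 < R) (hpos : ∀ x, R < ‖x‖ → 0 < u x)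
    (hg : ∀ x, R < ‖x‖ → 0 < g x) {r : ℝ} (hr : R < r) {x : EuclideanSpace ℝ (Fin N)}
    (hx : r ≤ ‖x‖) :
    sphereMin u r * (r / ‖x‖) ^ ((N - p) / (p - 1)) ≤ u x := by
  have hN : 0 < N := by exact_mod_cast (by linarith : (0 : ℝ) < N)
  have hp1 : 0 < p - 1 := by linarith
  set γ := (N - p) / (p - 1) with hγ
  have hγ0 : 0 < γ := div_pos (by linarith) hp1
  have h0 : 0 < r := hR.trans hr
  have hx0 : 0 < ‖x‖ := h0.trans_le hx
  have hm := hu.sphereMin_pos hN hR hpos hr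
  set m := sphereMin u r with hmdef
  have hb : 0 < m * r ^ γ := by positivity
  have key : ∀ s, ‖x‖ ≤ s → -(m * r ^ γ * s ^ (-γ)) + m * r ^ γ * ‖x‖ ^ (-γ) ≤ u x := by
    intro s hs
    have hs0 : 0 < s := hx0.trans_le hs
    refine hu.le_of_mem_annulus hp (σ := -γ) hr h0 hb.ne' (by linarith) ?_ ?_ ?_ hx hs
    · intro y hy
      have h1 : m ≤ u y := by
        have := hu.sphereMin_le hN hR (x := y) (by rw [hy]; linarith)
        rwa [hy] at this
      have h2 : 0 ≤ m * r ^ γ * s ^ (-γ) := by positivity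
      have h3 : m * r ^ γ * r ^ (-γ) = m := by rw [Real.rpow_neg h0.le]; field_simp
      linarith
    · intro y hy
      have := hpos y (by rw [hy]; linarith)
      linarith
    · intro y hy _ _
      have : (N : ℝ) + (-γ - 1) * (p - 1) - 1 = 0 := by rw [hγ]; field_simp; ring
      rw [this]
      simpa using hg y (hr.trans hy)
  have hlim : Tendsto (fun s : ℝ => -(m * r ^ γ * s ^ (-γ)) + m * r ^ γ * ‖x‖ ^ (-γ)) atTop
      (𝓝 (-(m * r ^ γ * 0) + m * r ^ γ * ‖x‖ ^ (-γ))) :=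
    (((tendsto_rpow_neg_atTop hγ0).const_mul _).neg).add_const _
  have := le_of_tendsto hlim ((eventually_ge_atTop ‖x‖).mono key)
  refine le_trans (le_of_eq ?_) this
  rw [Real.div_rpow h0.le hx0.le, Real.rpow_neg hx0.le]
  ring

lemma exists_mul_rpow_le_of_liminf_pos {f : ℝ → ℝ} {q : ℝ}
    (hf_cont : ContinuousOn f (Set.Ioi 0)) (hf_pos : ∀ t : ℝ, 0 < t → 0 < f t)
    (hf_liminf : 0 < liminf (fun t : ℝ => t ^ (-q) * f t) (𝓝[>] 0)) (M : ℝ) :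
    ∃ a > 0, ∀ t, 0 < t → t ≤ M → a * t ^ q ≤ f t := by
  have hrw : ∀ a t : ℝ, 0 < t → a ≤ t ^ (-q) * f t → a * t ^ q ≤ f t := by
    intro a t ht h
    have h1 : 0 < t ^ q := by positivity
    rw [Real.rpow_neg ht.le, le_inv_mul_iff₀ h1] at h
    linarith
  rw [Filter.liminf_eq] at hf_liminf
  have hne : {a : ℝ | ∀ᶠ t in 𝓝[>] 0, a ≤ t ^ (-q) * f t}.Nonempty := by
    by_contra h
    rw [Set.not_nonempty_iff_eq_empty.1 h, Real.sSup_empty] at hf_liminf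
    exact lt_irrefl _ hf_liminf
  obtain ⟨a₀, ha₀, ha₀'⟩ := exists_lt_of_lt_csSup hne hf_liminf
  obtain ⟨δ, hδ, hδ'⟩ := (mem_nhdsGT_iff_exists_Ioo_subset).1 ha₀
  have hδ0 : (0 : ℝ) < δ := hδ
  have hpos : ∀ t ∈ Set.Icc (δ / 2) (max M δ), 0 < t := fun t ht => by linarith [ht.1]
  have hcont : ContinuousOn (fun t => t ^ (-q) * f t) (Set.Icc (δ / 2) (max M δ)) :=
    (continuousOn_id.rpow_const fun t ht => Or.inl (hpos t ht).ne').mul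
      (hf_cont.mono fun t ht => hpos t ht)
  obtain ⟨s, hs, hmin⟩ := isCompact_Icc.exists_isMinOn
    ⟨δ, by linarith, le_max_right M δ⟩ hcont
  have hs0 := hpos s hs
  have hfs := hf_pos s hs0
  refine ⟨min a₀ (s ^ (-q) * f s), lt_min ha₀' (by positivity), fun t ht htM => hrw _ t ht ?_⟩
  rcases lt_or_ge t δ with h | h
  · exact (min_le_left _ _).trans (hδ' ⟨ht, h⟩)
  · exact (min_le_right _ _).trans (hmin ⟨by linarith, htM.trans (le_max_left _ _)⟩)

/-- A positive supersolution decays at least as fast as the fundamental solution. -/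
lemma IsPSupersolution.exists_sphereMin_mul_rpow_le (hp : 1 < p) (hpN : p < N)
    (hu : IsPSupersolution N p u g {x | R < ‖x‖}) (hR : 0 < R) (hpos : ∀ x, R < ‖x‖ → 0 < u x)
    (hg : ∀ x, R < ‖x‖ → 0 < g x) {r₀ a M : ℝ} (hr₀ : R < r₀) (ha : 0 < a)
    (hM : ∀ r, r₀ ≤ r → sphereMin u r ≤ M)
    (hf : ∀ x, R < ‖x‖ → u x ≤ M → a * u x ^ (N * (p - 1) / (N - p)) ≤ g x) :
    ∃ C, ∀ r, 4 * r₀ ≤ r → sphereMin u r * r ^ ((N - p) / (p - 1)) ≤ C := by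
  have hN : 0 < N := by exact_mod_cast (by linarith : (0 : ℝ) < N)
  have hp1 : 0 < p - 1 := by linarith
  have hNp : 0 < (N : ℝ) - p := by linarith
  have h0 : 0 < r₀ := hR.trans hr₀
  set γ := (N - p) / (p - 1) with hγ
  set q := N * (p - 1) / (N - p) with hq
  have hγ0 : 0 < γ := div_pos (by linarith) hp1
  have hq0 : 0 < q := by positivity
  have hqp : q = p / γ + (p - 1) := by rw [hq, hγ]; field_simp; ring
  have hhalf : (1 / 2 : ℝ) ^ γ < 1 := Real.rpow_lt_one (by norm_num) (by norm_num) hγ0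
  set c := min (1 - (1 / 2 : ℝ) ^ γ) ((2 / 3 : ℝ) ^ γ) with hc
  have hc0 : 0 < c := lt_min (by linarith) (by positivity)
  set D := (p / (p - 1) + 1) ^ (p - 1) * (N + p - 1) / (a * c ^ q) with hD
  have hD0 : 0 ≤ D := by
    have : (0 : ℝ) ≤ N + p - 1 := by linarith
    positivity
  refine ⟨2 ^ γ * D ^ (γ / p), fun r hr => ?_⟩
  set ρ := r / 2 with hρdef
  have hρ : 2 * r₀ ≤ ρ := by linarith
  have hρ0 : 0 < ρ := by linarith
  have hr2 : r = 2 * ρ := by linarith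
  obtain ⟨z, hz, hz'⟩ := hu.exists_eq_sphereMin hN hR (show R < r by linarith)
  have hm := hu.sphereMin_pos hN hR hpos (show R < r by linarith)
  have hmM := hM r (by linarith)
  set m := sphereMin u r with hmdef
  have hnorm : ∀ x ∈ Metric.closedBall z ρ, ρ ≤ ‖x‖ ∧ ‖x‖ ≤ 3 * ρ := by
    intro x hx
    rw [Metric.mem_closedBall, dist_eq_norm] at hx
    have h1 := norm_sub_norm_le x z
    have h2 := norm_sub_norm_le z x
    rw [norm_sub_rev] at h2
    constructor <;> linarith
  have hball : ∀ x ∈ Metric.closedBall z ρ, R < ‖x‖ := fun x hx => by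
    linarith [(hnorm x hx).1]
  obtain ⟨x, hx, hxz, hgx⟩ := hu.exists_mem_ball_le hp isOpen_norm_gt hg hρ0 hball
    (fun x hx => hpos x (hball x hx))
  have hxc := Metric.ball_subset_closedBall hx
  obtain ⟨hn1, hn2⟩ := hnorm x hxc
  have hxR := hball x hxc
  have hx0 : 0 < ‖x‖ := hR.trans hxR
  have hlow : c * m ≤ u x := by
    rcases le_total ‖x‖ r with h | h
    · refine le_trans ?_ (hu.one_sub_rpow_mul_sphereMin_le hp hpN hR hpos hg hr₀ (by linarith) h)
      refine mul_le_mul_of_nonneg_right ((min_le_left _ _).trans ?_) hm.le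
      have : (r₀ / ‖x‖) ^ γ ≤ (1 / 2 : ℝ) ^ γ := by
        refine Real.rpow_le_rpow (by positivity) ?_ hγ0.le
        rw [div_le_div_iff₀ hx0 (by norm_num)]
        linarith
      linarith
    · refine le_trans ?_ (hu.sphereMin_mul_rpow_le hp hpN hR hpos hg (by linarith) h)
      rw [mul_comm]
      refine mul_le_mul_of_nonneg_left ((min_le_right _ _).trans ?_) hm.le
      refine Real.rpow_le_rpow (by norm_num) ?_ hγ0.le
      rw [div_le_div_iff₀ (by norm_num) hx0]
      linarith
  have h1 := hf x hxR (by linarith)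
  rw [hz'] at hgx
  have h2 : (c * m) ^ q ≤ u x ^ q := Real.rpow_le_rpow (by positivity) hlow hq0.le
  have h3 : a * (c * m) ^ q ≤ (m * (p / (p - 1) + 1)) ^ (p - 1) * (N + p - 1) * ρ ^ (-p) :=
    (mul_le_mul_of_nonneg_left h2 ha.le).trans (h1.trans hgx)
  rw [Real.mul_rpow hc0.le hm.le, Real.mul_rpow hm.le (by positivity), hqp,
    Real.rpow_add hm, ← hqp, Real.rpow_neg hρ0.le] at h3
  have hmp : 0 < m ^ (p - 1) := by positivity
  have hρp : 0 < ρ ^ p := by positivity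
  have h4 : m ^ (p / γ) * ρ ^ p ≤ D := by
    rw [hD, le_div_iff₀ (by positivity)]
    refine le_of_mul_le_mul_right ?_ hmp
    calc m ^ (p / γ) * ρ ^ p * (a * c ^ q) * m ^ (p - 1)
        = a * (c ^ q * (m ^ (p / γ) * m ^ (p - 1))) * ρ ^ p := by ring
      _ ≤ m ^ (p - 1) * (p / (p - 1) + 1) ^ (p - 1) * (N + p - 1) * (ρ ^ p)⁻¹ * ρ ^ p := by
          gcongr
      _ = _ := by field_simp
  have h5 : m * ρ ^ γ = (m ^ (p / γ) * ρ ^ p) ^ (γ / p) := by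
    rw [Real.mul_rpow (by positivity) (by positivity), ← Real.rpow_mul hm.le,
      ← Real.rpow_mul hρ0.le, show p / γ * (γ / p) = 1 by field_simp,
      show p * (γ / p) = γ by field_simp, Real.rpow_one]
  calc m * r ^ γ = 2 ^ γ * (m * ρ ^ γ) := by
        rw [hr2, Real.mul_rpow (by norm_num) hρ0.le]; ring
    _ ≤ 2 ^ γ * D ^ (γ / p) := by
        rw [h5]
        gcongr

set_option maxHeartbeats 400000 in
/-- The decay of a positive supersolution, relative to the fundamental solution, slows down by a
fixed factor whenever the radius doubles. -/
lemma IsPSupersolution.exists_mul_sphereMin_le (hp : 1 < p) (hpN : p < N)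
    (hu : IsPSupersolution N p u g {x | R < ‖x‖}) (hR : 0 < R) (hpos : ∀ x, R < ‖x‖ → 0 < u x)
    (hg : ∀ x, R < ‖x‖ → 0 < g x) {r₀ a M k₀ : ℝ} (hr₀ : R < r₀) (ha : 0 < a) (hk₀ : 0 < k₀)
    (hM : ∀ r, r₀ ≤ r → sphereMin u r ≤ M)
    (hk : ∀ r, r₀ ≤ r → k₀ ≤ sphereMin u r * r ^ ((N - p) / (p - 1)))
    (hf : ∀ x, R < ‖x‖ → u x ≤ M → a * u x ^ (N * (p - 1) / (N - p)) ≤ g x) :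
    ∃ η > 1, ∀ r, r₀ ≤ r →
      η * sphereMin u r ≤ 2 ^ ((N - p) / (p - 1)) * sphereMin u (2 * r) := by
  have hN : 0 < N := by exact_mod_cast (by linarith : (0 : ℝ) < N)
  have hp1 : 0 < p - 1 := by linarith
  have hNp : 0 < (N : ℝ) - p := by linarith
  have h0 : 0 < r₀ := hR.trans hr₀
  set γ := (N - p) / (p - 1) with hγ
  set q := N * (p - 1) / (N - p) with hq
  have hγ0 : 0 < γ := div_pos (by linarith) hp1
  have hq0 : 0 < q := by positivity
  have hqp : q = p / γ + (p - 1) := by rw [hq, hγ]; field_simp; ring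
  have hqγ : γ * q = N := by rw [hq, hγ]; field_simp
  have h4half : (4 : ℝ) ^ (-(γ / 2)) < 1 :=
    Real.rpow_lt_one_of_one_lt_of_neg (by norm_num) (by linarith)
  set B₀ := 1 / (1 - (4 : ℝ) ^ (-(γ / 2))) with hB₀
  have hB₀0 : 0 < B₀ := one_div_pos.2 (by linarith)
  set E := a * k₀ ^ (p / γ) * (4 : ℝ) ^ (-(N : ℝ)) with hE
  have hE0 : 0 < E := by positivity
  set C := (B₀ * γ) ^ (p - 1) * (p - 1) with hC
  have hC0 : 0 < C := by positivity
  set δ := min (γ / 2) (E / (2 * C)) with hδ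
  have hδ0 : 0 < δ := lt_min (by linarith) (by positivity)
  have hδγ : δ ≤ γ / 2 := min_le_left _ _
  have hδC : C * δ < E := by
    have : C * δ ≤ C * (E / (2 * C)) := by gcongr; exact min_le_right _ _
    have h2 : C * (E / (2 * C)) = E / 2 := by field_simp
    linarith
  set σ := -γ + δ with hσ
  have hσ0 : σ < 0 := by linarith
  have h4σ : (4 : ℝ) ^ σ ≤ 4 ^ (-(γ / 2)) :=
    Real.rpow_le_rpow_of_exponent_le (by norm_num) (by linarith)
  have h4γ : (4 : ℝ) ^ (-γ) < 1 := Real.rpow_lt_one_of_one_lt_of_neg (by norm_num) (by linarith)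
  have h4γ0 : 0 < (4 : ℝ) ^ (-γ) := by positivity
  set B := (1 - (4 : ℝ) ^ (-γ)) / (1 - 4 ^ σ) with hB
  have hden : 0 < 1 - (4 : ℝ) ^ σ := by linarith
  have hB0 : 0 < B := div_pos (by linarith) hden
  have hBB₀ : B ≤ B₀ := by
    rw [hB, hB₀]
    gcongr
    linarith
  have hBeq : B * (1 - 4 ^ σ) = 1 - 4 ^ (-γ) := by rw [hB]; field_simp
  have hxy : (2 : ℝ) ^ (-γ) < 2 ^ σ := Real.rpow_lt_rpow_of_exponent_lt (by norm_num) (by linarith)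
  have h2γ : (2 : ℝ) ^ (-γ) < 1 := Real.rpow_lt_one_of_one_lt_of_neg (by norm_num) (by linarith)
  have h2σ : (2 : ℝ) ^ σ < 1 := Real.rpow_lt_one_of_one_lt_of_neg (by norm_num) hσ0
  have hsq : ∀ s : ℝ, (4 : ℝ) ^ s = 2 ^ s * 2 ^ s := fun s => by
    rw [← Real.mul_rpow (by norm_num) (by norm_num)]; norm_num
  have hΦ : (2 : ℝ) ^ (-γ) < 1 - B + B * 2 ^ σ := by
    have e1 : B * (1 - 2 ^ σ) * (1 + 2 ^ σ) = (1 - 2 ^ (-γ)) * (1 + (2 : ℝ) ^ (-γ)) := by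
      rw [hsq, hsq] at hBeq; linarith
    have e2 : 0 < (2 : ℝ) ^ (-γ) := by positivity
    nlinarith
  refine ⟨2 ^ γ * (1 - B + B * 2 ^ σ), ?_, fun r hr => ?_⟩
  · have : (2 : ℝ) ^ γ * 2 ^ (-γ) = 1 := by rw [← Real.rpow_add (by norm_num)]; simp
    calc (1 : ℝ) = 2 ^ γ * 2 ^ (-γ) := this.symm
      _ < _ := by gcongr
  have hr0 : 0 < r := h0.trans_le hr
  have hrR : R < r := by linarith
  have hm := hu.sphereMin_pos hN hR hpos hrR
  have hmM := hM r hr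
  have hkr := hk r hr
  obtain ⟨y, hy, hy'⟩ := hu.exists_eq_sphereMin hN hR (show R < 2 * r by linarith)
  rw [← hy', mul_assoc]
  have hle : ∀ x : EuclideanSpace ℝ (Fin N), ‖x‖ = r → sphereMin u r ≤ u x := by
    rintro x rfl
    exact hu.sphereMin_le hN hR hrR
  set m := sphereMin u r with hmdef
  have hdecay : ∀ x : EuclideanSpace ℝ (Fin N), r ≤ ‖x‖ → ‖x‖ ≤ 4 * r → m * 4 ^ (-γ) ≤ u x := by
    intro x hx1 hx2
    refine le_trans ?_ (hu.sphereMin_mul_rpow_le hp hpN hR hpos hg hrR hx1)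
    refine mul_le_mul_of_nonneg_left ?_ hm.le
    rw [Real.rpow_neg (by norm_num), ← Real.inv_rpow (by norm_num)]
    refine Real.rpow_le_rpow (by norm_num) ?_ hγ0.le
    rw [inv_eq_one_div, div_le_div_iff₀ (by norm_num) (by linarith)]
    linarith
  have hrσ : r ^ (-σ) * r ^ σ = 1 := by rw [← Real.rpow_add hr0]; simp
  set b := m * B * r ^ (-σ) with hb
  have hb0 : 0 < b := by positivity
  have hval : ∀ t : ℝ, 0 < t → m * (1 - B) + b * (t * r) ^ σ = m * (1 - B + B * t ^ σ) := by
    intro t ht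
    rw [hb, Real.mul_rpow ht.le hr0.le]
    linear_combination (m * B * t ^ σ) * hrσ
  have hval1 : m * (1 - B) + b * r ^ σ = m := by
    have := hval 1 one_pos
    rw [one_mul, Real.one_rpow] at this
    rw [this]; ring
  have key := hu.le_of_mem_annulus hp (a := m * (1 - B)) (b := b) (σ := σ) (r₂ := 4 * r) hrR hr0
    hb0.ne' hσ0.ne ?_ ?_ ?_ (x := y) (by linarith) (by linarith)
  · rw [hy, hval 2 two_pos] at key
    refine mul_le_mul_of_nonneg_left ?_ (by positivity)
    rwa [mul_comm]
  · intro x hx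
    rw [hval1]
    exact hle x hx
  · intro x hx
    rw [hval 4 (by norm_num)]
    refine le_trans (le_of_eq ?_) (hdecay x (by linarith) hx.le)
    congr 1
    linarith
  · intro x hx1 hx2 hux
    have hxR : R < ‖x‖ := hrR.trans hx1
    have hx0 : 0 < ‖x‖ := hR.trans hxR
    have hxM : u x ≤ M := by
      have : ‖x‖ ^ σ ≤ r ^ σ := Real.rpow_le_rpow_of_nonpos hr0 hx1.le hσ0.le
      have : b * ‖x‖ ^ σ ≤ b * r ^ σ := by gcongr
      linarith
    have hlow := hdecay x hx1.le hx2.le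
    have hbσ : b * σ < 0 := mul_neg_of_pos_of_neg hb0 hσ0
    rw [rpow_sub_two_mul_self_of_neg hbσ, neg_mul, neg_neg]
    have e1 : (N : ℝ) + (σ - 1) * (p - 1) - 1 = (p - 1) * δ := by
      rw [hσ, hγ]; field_simp; ring
    have e2 : |b * σ| ≤ m * (B₀ * γ) * r ^ (-σ) := by
      rw [abs_of_neg hbσ, hb]
      have : B * -σ ≤ B₀ * γ :=
        mul_le_mul hBB₀ (by linarith) (by linarith) hB₀0.le
      calc -(m * B * r ^ (-σ) * σ) = m * (B * -σ) * r ^ (-σ) := by ring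
        _ ≤ _ := by gcongr
    have e3 : |b * σ| ^ (p - 1) ≤ m ^ (p - 1) * (B₀ * γ) ^ (p - 1) * r ^ (-σ * (p - 1)) := by
      rw [Real.rpow_mul hr0.le, ← Real.mul_rpow hm.le (by positivity),
        ← Real.mul_rpow (by positivity) (by positivity)]
      exact Real.rpow_le_rpow (abs_nonneg _) e2 hp1.le
    have e4 : ‖x‖ ^ ((σ - 1) * (p - 1) - 1) ≤ r ^ ((σ - 1) * (p - 1) - 1) :=
      Real.rpow_le_rpow_of_nonpos hr0 hx1.le (by nlinarith)
    have e5 : r ^ (-σ * (p - 1)) * r ^ ((σ - 1) * (p - 1) - 1) = r ^ (-p) := by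
      rw [← Real.rpow_add hr0]; ring_nf
    have e6 : k₀ ^ (p / γ) * r ^ (-p) ≤ m ^ (p / γ) := by
      have h1 : k₀ ^ (p / γ) ≤ (m * r ^ γ) ^ (p / γ) :=
        Real.rpow_le_rpow hk₀.le hkr (by positivity)
      rw [Real.mul_rpow hm.le (by positivity), ← Real.rpow_mul hr0.le,
        show γ * (p / γ) = p by field_simp] at h1
      rw [Real.rpow_neg hr0.le, ← div_eq_mul_inv, div_le_iff₀ (by positivity)]
      exact h1
    have e7 : (m * 4 ^ (-γ)) ^ q = m ^ (p / γ) * m ^ (p - 1) * 4 ^ (-(N : ℝ)) := by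
      rw [Real.mul_rpow hm.le h4γ0.le, ← Real.rpow_mul (by norm_num), neg_mul, hqγ,
        ← Real.rpow_add hm, ← hqp]
    have hmp : 0 < m ^ (p - 1) := by positivity
    calc |b * σ| ^ (p - 1) * ((N + (σ - 1) * (p - 1) - 1) * ‖x‖ ^ ((σ - 1) * (p - 1) - 1))
        ≤ m ^ (p - 1) * (B₀ * γ) ^ (p - 1) * r ^ (-σ * (p - 1)) *
          (((p - 1) * δ) * r ^ ((σ - 1) * (p - 1) - 1)) := by
          rw [e1]
          gcongr
      _ = m ^ (p - 1) * (C * δ) *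
          (r ^ (-σ * (p - 1)) * r ^ ((σ - 1) * (p - 1) - 1)) := by rw [hC]; ring
      _ = m ^ (p - 1) * (C * δ) * r ^ (-p) := by rw [e5]
      _ < m ^ (p - 1) * E * r ^ (-p) := by gcongr
      _ = a * ((k₀ ^ (p / γ) * r ^ (-p)) * m ^ (p - 1) * 4 ^ (-(N : ℝ))) := by rw [hE]; ring
      _ ≤ a * (m ^ (p / γ) * m ^ (p - 1) * 4 ^ (-(N : ℝ))) := by gcongr
      _ = a * (m * 4 ^ (-γ)) ^ q := by rw [e7]
      _ ≤ a * u x ^ q := by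
          have : (m * 4 ^ (-γ)) ^ q ≤ u x ^ q :=
            Real.rpow_le_rpow (by positivity) hlow hq0.le
          gcongr
      _ ≤ g x := hf x hxR hxM

end Supersolution

/-- If `N ≥ 2`, `1 < p < N`, `p_* = N(p-1)/(N-p)`, and `f : (0,∞) → (0,∞)` is continuous with
`liminf_{t→0⁺} t^{-p_*} f(t) > 0`, then for every `R > 0` there is no positive classical
supersolution of `-Δ_p u ≥ f(u)` on the exterior domain `{‖x‖ > R}`. -/
theorem liouville_pLaplacian_p_lt_N (N : ℕ) (hN : 2 ≤ N) (p : ℝ) (hp : 1 < p)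
    (hpN : p < N) (f : ℝ → ℝ)
    (hf_cont : ContinuousOn f (Set.Ioi 0)) (hf_pos : ∀ t : ℝ, 0 < t → 0 < f t)
    (hf_liminf :
      0 < Filter.liminf (fun t : ℝ => t ^ (-((N : ℝ) * (p - 1) / ((N : ℝ) - p))) * f t)
        (nhdsWithin 0 (Set.Ioi 0)))
    (R : ℝ) (hR : 0 < R) :
    ¬ ∃ u : EuclideanSpace ℝ (Fin N) → ℝ,
      (∀ x : EuclideanSpace ℝ (Fin N), R < ‖x‖ → 0 < u x) ∧
      IsPSupersolution N p u (fun x => f (u x)) {x : EuclideanSpace ℝ (Fin N) | R < ‖x‖} := by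
  rintro ⟨u, hpos, hu⟩
  have hg : ∀ x : EuclideanSpace ℝ (Fin N), R < ‖x‖ → 0 < f (u x) := fun x hx =>
    hf_pos _ (hpos x hx)
  have hN0 : 0 < N := by omega
  have hγ0 : 0 < (N - p) / (p - 1) := div_pos (by linarith) (by linarith)
  have hhalf : (1 / 2 : ℝ) ^ ((N - p) / (p - 1)) < 1 :=
    Real.rpow_lt_one (by norm_num) (by norm_num) hγ0
  have hm : ∀ {r : ℝ}, R < r → 0 < sphereMin u r := fun hr =>
    hu.sphereMin_pos hN0 hR hpos hr
  set r₁ := 4 * R with hr₁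
  set M := u (EuclideanSpace.single ⟨0, hN0⟩ r₁) /
    (1 - (1 / 2 : ℝ) ^ ((N - p) / (p - 1))) with hMdef
  have hM : ∀ r, r₁ ≤ r → sphereMin u r ≤ M := by
    intro r hr
    have hnorm : ‖EuclideanSpace.single (⟨0, hN0⟩ : Fin N) r₁‖ = r₁ := by
      simp [hr₁, abs_of_pos hR]
    have h := hu.one_sub_rpow_mul_sphereMin_le hp hpN hR hpos hg (r₀ := 2 * R) (r := r)
      (x := EuclideanSpace.single ⟨0, hN0⟩ r₁) (by linarith) (by linarith) (by linarith)
    rw [hnorm, show 2 * R / r₁ = 1 / 2 by rw [hr₁]; field_simp; norm_num] at h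
    rw [hMdef, le_div_iff₀ (by linarith)]
    linarith
  obtain ⟨a, ha, hfa⟩ := exists_mul_rpow_le_of_liminf_pos hf_cont hf_pos hf_liminf M
  have hfa' : ∀ x : EuclideanSpace ℝ (Fin N), R < ‖x‖ → u x ≤ M →
      a * u x ^ (N * (p - 1) / (N - p)) ≤ f (u x) := fun x hx hxM => hfa _ (hpos x hx) hxM
  set γ := (N - p) / (p - 1) with hγ
  have hk : ∀ r, r₁ ≤ r → sphereMin u r₁ * r₁ ^ γ ≤ sphereMin u r * r ^ γ := by
    intro r hr
    have hr0 : 0 < r := by linarith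
    obtain ⟨x, hx, hx'⟩ := hu.exists_eq_sphereMin hN0 hR (show R < r by linarith)
    have h := hu.sphereMin_mul_rpow_le hp hpN hR hpos hg (r := r₁) (x := x) (by linarith)
      (by linarith)
    rw [hx, hx', ← hγ, Real.div_rpow (by linarith) hr0.le, ← mul_div_assoc,
      div_le_iff₀ (by positivity)] at h
    exact h
  have hk₀ : 0 < sphereMin u r₁ * r₁ ^ γ :=
    mul_pos (hm (by linarith)) (Real.rpow_pos_of_pos (by linarith) _)
  obtain ⟨C, hC⟩ := hu.exists_sphereMin_mul_rpow_le hp hpN hR hpos hg (show R < r₁ by linarith)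
    ha hM hfa'
  obtain ⟨η, hη, hη'⟩ := hu.exists_mul_sphereMin_le hp hpN hR hpos hg (show R < r₁ by linarith)
    ha hk₀ hM hk hfa'
  have hgrow : ∀ n : ℕ, η ^ n * (sphereMin u (4 * r₁) * (4 * r₁) ^ γ) ≤
      sphereMin u (2 ^ n * (4 * r₁)) * (2 ^ n * (4 * r₁)) ^ γ := by
    intro n
    induction n with
    | zero => simp
    | succ n ih =>
      have h1 : (1 : ℝ) ≤ 2 ^ n := one_le_pow₀ (by norm_num)
      have hr : r₁ ≤ 2 ^ n * (4 * r₁) := by nlinarith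
      rw [pow_succ', pow_succ', mul_assoc, mul_assoc]
      set r := 2 ^ n * (4 * r₁)
      have hr0 : 0 < r := by linarith
      have hr0' : 0 < r ^ γ := by positivity
      calc η * (η ^ n * (sphereMin u (4 * r₁) * (4 * r₁) ^ γ))
          ≤ η * (sphereMin u r * r ^ γ) := by gcongr
        _ = η * sphereMin u r * r ^ γ := by ring
        _ ≤ 2 ^ γ * sphereMin u (2 * r) * r ^ γ := 
          mul_le_mul_of_nonneg_right (hη' r hr) hr0'.le
        _ = _ := by rw [Real.mul_rpow (by norm_num) hr0.le]; ring
  have hK : 0 < sphereMin u (4 * r₁) * (4 * r₁) ^ γ :=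
    mul_pos (hm (by linarith)) (Real.rpow_pos_of_pos (by linarith) _)
  obtain ⟨n, hn⟩ := pow_unbounded_of_one_lt (C / (sphereMin u (4 * r₁) * (4 * r₁) ^ γ)) hη
  rw [div_lt_iff₀ hK] at hn
  have h1 : (1 : ℝ) ≤ 2 ^ n := one_le_pow₀ (by norm_num)
  have := hC (2 ^ n * (4 * r₁)) (by nlinarith)
  linarith [hgrow n]
end

section
/- Let N ≥ 3 and let λ satisfy 1/(N−1) < λ < 1. Set λ* = (N−1+λ)/(N−1−λ). Let f : ℝ → ℝ be continuous on (0,∞) with f(t) > 0 for all t > 0, and suppose liminf_{t→0⁺} t^{−λ*} f(t) > 0. Then for every R > 0 there is no function u : EuclideanSpace ℝ (Fin N) → ℝ which is positive and C² on the exterior domain Ω = {x : ‖x‖ > R} and satisfies P⁺_{λ,1}(D²u(x)) ≥ f(u(x)) for all x ∈ Ω. -/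
open MeasureTheory Filter Real Matrix
open scoped RealInnerProductSpace

/-- The Pucci maximal operator `P⁺_{λ,Λ}(M)`. -/
noncomputable def pucciMax (N : ℕ) (lam Lam : ℝ) (M : Matrix (Fin N) (Fin N) ℝ) : ℝ :=
  sSup {t : ℝ | ∃ A : Matrix (Fin N) (Fin N) ℝ, A.IsSymm ∧
    (∀ ξ : Fin N → ℝ, lam * ∑ i, ξ i ^ 2 ≤ ξ ⬝ᵥ A.mulVec ξ ∧
      ξ ⬝ᵥ A.mulVec ξ ≤ Lam * ∑ i, ξ i ^ 2) ∧
    t = Matrix.trace (-(A * M))}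

/-- The Hessian matrix of `u` at `x`, in the standard orthonormal basis. -/
noncomputable def hessianMatrix (N : ℕ) (u : EuclideanSpace ℝ (Fin N) → ℝ)
    (x : EuclideanSpace ℝ (Fin N)) : Matrix (Fin N) (Fin N) ℝ :=
  Matrix.of fun i j => iteratedFDeriv ℝ 2 u x
    ![EuclideanSpace.basisFun (Fin N) ℝ i, EuclideanSpace.basisFun (Fin N) ℝ j]

/-- The Pucci maximal operator `P⁺_{λ,1}` on a single eigenvalue. -/
noncomputable def pucciScalar (lam t : ℝ) : ℝ := max (-t) (-(lam * t))

lemma pucciScalar_le_abs {lam : ℝ} (h0 : 0 < lam) (h1 : lam < 1) (t : ℝ) :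
    pucciScalar lam t ≤ |t| := by
  refine max_le (neg_le_abs t) ?_
  rcases abs_cases t with ⟨h, h'⟩ | ⟨h, h'⟩ <;> rw [h] <;> nlinarith

lemma pucciScalar_of_nonneg {lam t : ℝ} (h1 : lam < 1) (ht : 0 ≤ t) :
    pucciScalar lam t = -(lam * t) := max_eq_right (by nlinarith)

lemma pucciScalar_of_nonpos {lam t : ℝ} (h1 : lam < 1) (ht : t ≤ 0) :
    pucciScalar lam t = -t := max_eq_left (by nlinarith)

lemma neg_mul_le_pucciScalar {lam a t : ℝ} (h0 : lam ≤ a) (h1 : a ≤ 1) :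
    -(a * t) ≤ pucciScalar lam t := by
  unfold pucciScalar
  rcases le_total 0 t with h | h
  · exact le_max_of_le_right (by nlinarith)
  · exact le_max_of_le_left (by nlinarith)

/-- `m` is a supersolution, in the viscosity sense, of the radial form of
`P⁺_{λ,1}(D²u) = f(u)` on `(R, ∞)`, in dimension `n + 1`. The formulation includes the
attainment of minima of `m - φ` on compact intervals. -/
def RadialSupersolution (n lam R : ℝ) (f m : ℝ → ℝ) : Prop :=
  ∀ a b : ℝ, R < a → a < b → ∀ φ φ₁ φ₂ : ℝ → ℝ,
    (∀ r, 0 < r → HasDerivAt φ (φ₁ r) r) → (∀ r, 0 < r → HasDerivAt φ₁ (φ₂ r) r) →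
    ∃ r ∈ Set.Icc a b, (∀ s ∈ Set.Icc a b, m r - φ r ≤ m s - φ s) ∧
      (a < r → r < b → f (m r) ≤ pucciScalar lam (φ₂ r) + n * pucciScalar lam (φ₁ r / r))

namespace RadialSupersolution

variable {n lam R : ℝ} {f m : ℝ → ℝ}

lemma comparison (H : RadialSupersolution n lam R f m) {a b : ℝ} (ha : R < a) (hab : a < b)
    {φ φ₁ φ₂ : ℝ → ℝ} (h₁ : ∀ r, 0 < r → HasDerivAt φ (φ₁ r) r)
    (h₂ : ∀ r, 0 < r → HasDerivAt φ₁ (φ₂ r) r) (hφa : φ a ≤ m a) (hφb : φ b ≤ m b)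
    (hP : ∀ r, a < r → r < b →
      pucciScalar lam (φ₂ r) + n * pucciScalar lam (φ₁ r / r) < f (m r))
    {s : ℝ} (hs : s ∈ Set.Icc a b) : φ s ≤ m s := by
  obtain ⟨r, ⟨har, hrb⟩, hmin, hr⟩ := H a b ha hab φ φ₁ φ₂ h₁ h₂
  have hmins := hmin s hs
  rcases har.eq_or_lt with rfl | har
  · linarith
  rcases hrb.eq_or_lt with rfl | hrb
  · linarith
  exact absurd (hr har hrb) (not_le.2 (hP r har hrb))

lemma comparison_atTop (H : RadialSupersolution n lam R f m) (hm : ∀ r, R < r → 0 < m r)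
    {a : ℝ} (ha : R < a) {φ φ₁ φ₂ : ℝ → ℝ} (h₁ : ∀ r, 0 < r → HasDerivAt φ (φ₁ r) r)
    (h₂ : ∀ r, 0 < r → HasDerivAt φ₁ (φ₂ r) r) (hφa : φ a ≤ m a)
    (hφ : ∀ r, a < r → 0 ≤ φ r) (hlim : Tendsto φ atTop (nhds 0))
    (hP : ∀ r, a < r →
      pucciScalar lam (φ₂ r) + n * pucciScalar lam (φ₁ r / r) < f (m r))
    {s : ℝ} (hs : a ≤ s) : φ s ≤ m s := by
  have key : ∀ᶠ ρ in atTop, φ s - φ ρ ≤ m s := by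
    filter_upwards [eventually_gt_atTop s] with ρ hρ
    have haρ : a < ρ := hs.trans_lt hρ
    refine H.comparison ha haρ (φ := fun r => φ r - φ ρ) (fun r hr => (h₁ r hr).sub_const _) h₂
      ?_ ?_ (fun r h _ => hP r h) ⟨hs, hρ.le⟩
    · linarith [hφ ρ haρ]
    · simpa using (hm ρ (ha.trans haρ)).le
  have : Tendsto (fun ρ => φ s - φ ρ) atTop (nhds (φ s - 0)) := hlim.const_sub _
  simpa using le_of_tendsto this key

lemma quadratic_test (H : RadialSupersolution n lam R f m) (hn : 0 ≤ n) (hR : 0 < R)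
    (h0 : 0 < lam) (h1 : lam < 1) (hm : ∀ r, R < r → 0 < m r) {ρ k : ℝ} (hρ : 2 * R < ρ)
    (hk : 0 ≤ k) (hkρ : 4 * m ρ ≤ k * ρ ^ 2) :
    ∃ r ∈ Set.Icc (ρ / 2) (3 * ρ / 2), f (m r) ≤ 2 * k * (1 + n) := by
  have hρ0 : 0 < ρ := by linarith
  obtain ⟨r, ⟨har, hrb⟩, hmin, hr⟩ := H (ρ / 2) (3 * ρ / 2) (by linarith) (by linarith)
    (fun r => -k * (r - ρ) ^ 2) (fun r => -2 * k * (r - ρ)) (fun _ => -2 * k)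
    (fun r _ => by
      have := (((hasDerivAt_id r).sub_const ρ).pow 2).const_mul (-k)
      refine this.congr_deriv ?_
      simp; ring)
    (fun r _ => by
      have := ((hasDerivAt_id r).sub_const ρ).const_mul (-2 * k)
      refine this.congr_deriv ?_
      simp)
  have hmid := hmin ρ ⟨by linarith, by linarith⟩
  have hmr : 0 < m r := hm r (by linarith)
  refine ⟨r, ⟨har, hrb⟩, ?_⟩
  rcases har.eq_or_lt with rfl | har
  · exfalso; nlinarith
  rcases hrb.eq_or_lt with rfl | hrb
  · exfalso; nlinarith
  have hr0 : 0 < r := by linarith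
  have e1 : pucciScalar lam (-2 * k) ≤ 2 * k := by
    refine (pucciScalar_le_abs h0 h1 _).trans (le_of_eq ?_)
    rw [abs_mul, abs_of_nonneg hk]; norm_num
  have e2 : pucciScalar lam (-2 * k * (r - ρ) / r) ≤ 2 * k := by
    refine (pucciScalar_le_abs h0 h1 _).trans ?_
    rw [abs_div, abs_of_pos hr0, div_le_iff₀ hr0, abs_mul, abs_mul, abs_of_nonneg hk]
    have : |r - ρ| ≤ r := abs_le.2 ⟨by linarith, by linarith⟩
    norm_num
    gcongr
  have := hr har hrb
  nlinarith [mul_le_mul_of_nonneg_left e2 hn]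

lemma hasDerivAt_mul_rpow (k p : ℝ) {r : ℝ} (hr : 0 < r) :
    HasDerivAt (fun r : ℝ => k * r ^ p) (k * p * r ^ (p - 1)) r := by
  have := (Real.hasDerivAt_rpow_const (p := p) (Or.inl hr.ne')).const_mul k
  exact this.congr_deriv (by ring)

/-- The good-ellipticity condition `1 < nλ` bounds radial supersolutions from above. -/
lemma bounded (H : RadialSupersolution n lam R f m) (hR : 0 < R)
    (h1 : lam < 1) (hnl : 1 < n * lam) (hm : ∀ r, R < r → 0 < m r)
    (hf : ∀ t, 0 < t → 0 < f t) :
    ∃ K, ∀ r, R + 2 < r → m r ≤ K := by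
  set β := n * lam - 1 with hβ
  have hβ0 : 0 < β := by linarith
  have hd : 0 < (R + 1) ^ (-β) - (R + 2) ^ (-β) :=
    sub_pos.2 (Real.rpow_lt_rpow_of_neg (by linarith) (by linarith) (by linarith))
  set κ := (m (R + 2) + 1) / ((R + 1) ^ (-β) - (R + 2) ^ (-β)) with hκ
  have hκ0 : 0 < κ := div_pos (by linarith [hm (R + 2) (by linarith)]) hd
  refine ⟨κ * (R + 1) ^ (-β), fun r hr => ?_⟩
  by_contra! hcon
  have hP := H.comparison (a := R + 1) (b := r) (by linarith) (by linarith)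
    (φ := fun s => κ * (R + 1) ^ (-β) + (-κ) * s ^ (-β))
    (fun s hs => (hasDerivAt_mul_rpow (-κ) (-β) hs).const_add _)
    (fun s hs => hasDerivAt_mul_rpow (-κ * (-β)) (-β - 1) hs)
    (by simpa using (hm (R + 1) (by linarith)).le)
    (by
      have : 0 < r ^ (-β) := Real.rpow_pos_of_pos (by linarith) _
      nlinarith)
    (fun s hs _ => by
      have hs0 : 0 < s := by linarith
      have hpow : 0 < s ^ (-β - 1 - 1) := Real.rpow_pos_of_pos hs0 _
      have e : -κ * -β * s ^ (-β - 1) / s = κ * β * s ^ (-β - 1 - 1) := by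
        rw [Real.rpow_sub_one hs0.ne' (-β - 1)]; ring
      have hκβ : 0 < κ * β * s ^ (-β - 1 - 1) := by positivity
      rw [e, pucciScalar_of_nonneg h1 hκβ.le, pucciScalar_of_nonpos h1 (by nlinarith)]
      refine lt_of_eq_of_lt ?_ (hf _ (hm s (by linarith)))
      rw [hβ]; ring)
    (s := R + 2) ⟨by linarith, hr.le⟩
  have : κ * ((R + 1) ^ (-β) - (R + 2) ^ (-β)) = m (R + 2) + 1 := div_mul_cancel₀ _ hd.ne'
  linarith

lemma exists_lt (H : RadialSupersolution n lam R f m) (hn : 0 ≤ n) (hR : 0 < R)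
    (h0 : 0 < lam) (h1 : lam < 1) (hnl : 1 < n * lam) (hm : ∀ r, R < r → 0 < m r)
    (hf : ∀ t, 0 < t → 0 < f t) (hfc : ContinuousOn f (Set.Ioi 0)) {δ : ℝ} (hδ : 0 < δ)
    (r₀ : ℝ) : ∃ r, r₀ < r ∧ m r < δ := by
  by_contra! hcon
  obtain ⟨K, hK⟩ := H.bounded hR h1 hnl hm hf
  have hδK : δ ≤ K :=
    (hcon (max r₀ (R + 2) + 1) (by linarith [le_max_left r₀ (R + 2)])).trans
      (hK _ (by linarith [le_max_right r₀ (R + 2)]))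
  obtain ⟨t, ht, htmin⟩ := (isCompact_Icc (a := δ) (b := K)).exists_isMinOn
    (Set.nonempty_Icc.2 hδK) (hfc.mono fun t ht => hδ.trans_le ht.1)
  have hft : 0 < f t := hf t (hδ.trans_le ht.1)
  set k := f t / (4 * (1 + n)) with hk
  have hk0 : 0 < k := by positivity
  have hlarge : ∀ᶠ ρ : ℝ in atTop, 4 * K < k * ρ ^ 2 :=
    ((tendsto_pow_atTop two_ne_zero).const_mul_atTop hk0).eventually_gt_atTop _
  obtain ⟨ρ, hρ, hρ'⟩ :=
    (hlarge.and (eventually_gt_atTop (2 * max r₀ (R + 2)))).exists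
  have hr₀ := le_max_left r₀ (R + 2)
  have hR2 := le_max_right r₀ (R + 2)
  obtain ⟨r, ⟨hr, _⟩, hfr⟩ := H.quadratic_test hn hR h0 h1 hm (ρ := ρ) (k := k)
    (by linarith) hk0.le (by linarith [hK ρ (by linarith)])
  have : f t ≤ f (m r) := htmin ⟨hcon r (by linarith), hK r (by linarith)⟩
  have e : 2 * k * (1 + n) = f t / 2 := by rw [hk]; field_simp; norm_num
  linarith

lemma exists_antitone_tail (H : RadialSupersolution n lam R f m) (hn : 0 ≤ n) (hR : 0 < R)
    (h0 : 0 < lam) (h1 : lam < 1) (hnl : 1 < n * lam) (hm : ∀ r, R < r → 0 < m r)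
    (hf : ∀ t, 0 < t → 0 < f t) (hfc : ContinuousOn f (Set.Ioi 0)) {δ : ℝ} (hδ : 0 < δ) :
    ∃ r₁, R < r₁ ∧ (∀ r, r₁ ≤ r → m r < δ) ∧ ∀ r s, r₁ ≤ r → r ≤ s → m s ≤ m r := by
  have ha : 0 < m (R + 1) := hm _ (by linarith)
  obtain ⟨r₁, hr₁, hmr₁⟩ := H.exists_lt hn hR h0 h1 hnl hm hf hfc (lt_min hδ ha) (R + 1)
  have step : ∀ r s, R + 1 < r → r ≤ s → m r < m (R + 1) → m s ≤ m r := by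
    intro r s hr hrs hlt
    by_contra! hcon
    have := H.comparison (a := R + 1) (b := s) (by linarith) (by linarith)
      (φ := fun _ => min (m (R + 1)) (m s)) (φ₁ := fun _ => 0) (φ₂ := fun _ => 0)
      (fun r _ => hasDerivAt_const _ _) (fun r _ => hasDerivAt_const _ _)
      (min_le_left _ _) (min_le_right _ _)
      (fun r hr _ => by simpa [pucciScalar] using hf _ (hm r (by linarith)))
      (s := r) ⟨hr.le, hrs⟩
    rcases min_le_iff.1 this with h | h <;> linarith
  have hle : ∀ r, r₁ ≤ r → m r ≤ m r₁ := fun r hr =>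
    step r₁ r hr₁ hr (hmr₁.trans_le (min_le_right _ _))
  refine ⟨r₁, by linarith, fun r hr => (hle r hr).trans_lt (hmr₁.trans_le (min_le_left _ _)),
    fun r s hr hrs => step r s (hr₁.trans_le hr) hrs ?_⟩
  exact (hle r hr).trans_lt (hmr₁.trans_le (min_le_right _ _))

/-- Comparison with the decreasing fundamental solution `r ^ (-α)`, where `λ(α + 1) = n`. -/
lemma mul_rpow_mono (H : RadialSupersolution n lam R f m) (hR : 0 < R)
    (h1 : lam < 1) (hm : ∀ r, R < r → 0 < m r) (hf : ∀ t, 0 < t → 0 < f t)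
    {α : ℝ} (hα : 0 < α) (hαn : lam * (α + 1) = n) {r s : ℝ} (hr : R < r) (hrs : r ≤ s) :
    m r * r ^ α * s ^ (-α) ≤ m s := by
  have hr0 : 0 < r := hR.trans hr
  set b := m r * r ^ α with hb
  have hb0 : 0 < b := mul_pos (hm r hr) (Real.rpow_pos_of_pos hr0 _)
  refine H.comparison_atTop hm hr (φ := fun s => b * s ^ (-α))
    (fun s hs => hasDerivAt_mul_rpow b (-α) hs)
    (fun s hs => hasDerivAt_mul_rpow (b * (-α)) (-α - 1) hs) ?_ ?_ ?_ ?_ hrs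
  · rw [hb, mul_assoc, ← Real.rpow_add hr0]; simp
  · intro s hs
    have := Real.rpow_pos_of_pos (hr0.trans hs) (-α)
    positivity
  · simpa using (tendsto_rpow_neg_atTop hα).const_mul b
  · intro s hs
    have hs0 : 0 < s := hr0.trans hs
    have hpow : 0 < s ^ (-α - 1 - 1) := Real.rpow_pos_of_pos hs0 _
    have e : b * -α * s ^ (-α - 1) / s = -(b * α * s ^ (-α - 1 - 1)) := by
      rw [Real.rpow_sub_one hs0.ne' (-α - 1)]; ring
    have hbα : 0 < b * α * s ^ (-α - 1 - 1) := by positivity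
    have e' : b * -α * (-α - 1) * s ^ (-α - 1 - 1) =
      (α + 1) * (b * α * s ^ (-α - 1 - 1)) := by ring
    rw [e, e', pucciScalar_of_nonneg h1 (by positivity), pucciScalar_of_nonpos h1 (by linarith)]
    refine lt_of_eq_of_lt ?_ (hf _ (hm s (by linarith)))
    rw [← hαn]; ring

lemma hasDerivAt_rpow_mul_log (p a b : ℝ) {r : ℝ} (hr : 0 < r) :
    HasDerivAt (fun r : ℝ => r ^ p * (a * log r + b))
      (r ^ (p - 1) * (p * a * log r + (p * b + a))) r := by
  have := (Real.hasDerivAt_rpow_const (p := p) (Or.inl hr.ne')).mul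
    (((Real.hasDerivAt_log hr.ne').const_mul a).add_const b)
  refine this.congr_deriv ?_
  rw [Real.rpow_sub_one hr.ne']
  field_simp
  ring

/-- In the critical case the lower bound `r ^ (-α)` improves by a logarithm. -/
lemma exists_log_lower_bound (H : RadialSupersolution n lam R f m)
    (h0 : 0 < lam) (h1 : lam < 1) (hm : ∀ r, R < r → 0 < m r)
    {α : ℝ} (hα : 1 < α) (hαn : lam * (α + 1) = n) {r₁ κ : ℝ} (hr₁ : R < r₁)
    (hr₁' : exp 2 ≤ r₁) (hκ : 0 < κ) (hfm : ∀ r, r₁ < r → κ * r ^ (-α - 2) ≤ f (m r)) :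
    ∃ ε, 0 < ε ∧ ∀ r, r₁ ≤ r → ε * (r ^ (-α) * log r) ≤ m r := by
  have hr₁0 : 0 < r₁ := (exp_pos 2).trans_le hr₁'
  have hlog : ∀ r, r₁ ≤ r → 2 ≤ log r := fun r hr =>
    (Real.le_log_iff_exp_le (hr₁0.trans_le hr)).2 (hr₁'.trans hr)
  have hq : 0 < r₁ ^ (-α) * log r₁ :=
    mul_pos (Real.rpow_pos_of_pos hr₁0 _) (by linarith [hlog r₁ le_rfl])
  have hm₁ := hm r₁ hr₁
  have hlα : 0 < lam * α := by positivity
  obtain ⟨ε, hε, hε'⟩ : ∃ ε, 0 < ε ∧ ε < min (m r₁ / (r₁ ^ (-α) * log r₁)) (κ / (lam * α)) :=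
    exists_between (lt_min (by positivity) (by positivity))
  have hε₁ := (lt_div_iff₀ hq).1 (hε'.trans_le (min_le_left _ _))
  have hε₂ := (lt_div_iff₀ hlα).1 (hε'.trans_le (min_le_right _ _))
  refine ⟨ε, hε, fun r hr => ?_⟩
  have := H.comparison_atTop hm hr₁ (φ := fun r => r ^ (-α) * (ε * log r + 0))
    (fun r hr => hasDerivAt_rpow_mul_log _ _ _ hr)
    (fun r hr => hasDerivAt_rpow_mul_log _ _ _ hr) (by linarith) ?_ ?_ ?_ hr
  · linarith
  · intro r hr
    have := Real.rpow_pos_of_pos (hr₁0.trans hr) (-α)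
    have := hlog r hr.le
    have : 0 ≤ log r := by linarith
    simp only [add_zero]
    positivity
  · have := ((isLittleO_log_rpow_atTop (r := α) (by linarith)).tendsto_div_nhds_zero).const_mul ε
    rw [mul_zero] at this
    refine this.congr' ?_
    filter_upwards [eventually_gt_atTop 0] with r hr
    rw [Real.rpow_neg hr.le]
    ring
  · intro r hr
    have hr0 : 0 < r := hr₁0.trans hr
    have hL := hlog r hr.le
    set L := log r
    have hpow : 0 < r ^ (-α - 2) := Real.rpow_pos_of_pos hr0 _
    have e2 : -α - 1 - 1 = -α - 2 := by ring
    have e : r ^ (-α - 1) * (-α * ε * L + (-α * 0 + ε)) / r =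
        r ^ (-α - 2) * (-(ε * (α * L - 1))) := by
      rw [← e2, Real.rpow_sub_one hr0.ne' (-α - 1)]; ring
    have hA : 0 ≤ α * L - 1 := by nlinarith
    have hB : 0 ≤ α * (α + 1) * L - (2 * α + 1) := by nlinarith
    have e' : r ^ (-α - 1 - 1) * ((-α - 1) * (-α * ε) * L + ((-α - 1) * (-α * 0 + ε) + -α * ε)) =
        r ^ (-α - 2) * (ε * (α * (α + 1) * L - (2 * α + 1))) := by
      rw [e2]; ring
    rw [e, e', pucciScalar_of_nonneg h1 (by positivity),
      pucciScalar_of_nonpos h1 (mul_nonpos_of_nonneg_of_nonpos hpow.le (by nlinarith))]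
    refine lt_of_lt_of_le ?_ (hfm r hr)
    have : -(lam * (r ^ (-α - 2) * (ε * (α * (α + 1) * L - (2 * α + 1))))) +
        n * -(r ^ (-α - 2) * -(ε * (α * L - 1))) = ε * (lam * α) * r ^ (-α - 2) := by
      rw [← hαn]; ring
    rw [this]
    gcongr

/-- There is no positive radial supersolution in the critical case. -/
theorem false_of_critical (H : RadialSupersolution n lam R f m) (hR : 0 < R)
    (h0 : 0 < lam) (h1 : lam < 1) (hnl : 1 < n * lam) (hm : ∀ r, R < r → 0 < m r)
    (hf : ∀ t, 0 < t → 0 < f t) (hfc : ContinuousOn f (Set.Ioi 0))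
    {α : ℝ} (hα : 1 < α) (hαn : lam * (α + 1) = n) {c δ : ℝ} (hc : 0 < c) (hδ : 0 < δ)
    (hfα : ∀ t, 0 < t → t < δ → c * t ^ (1 + 2 / α) ≤ f t) : False := by
  have hα0 : 0 < α := by linarith
  have hn : 0 < n := by rw [← hαn]; positivity
  obtain ⟨r₀, hr₀, hsmall, hanti⟩ := H.exists_antitone_tail hn.le hR h0 h1 hnl hm hf hfc hδ
  set r₁ := max r₀ (exp 2)
  have hr₀₁ : r₀ ≤ r₁ := le_max_left _ _
  have hr₁ : R < r₁ := hr₀.trans_le hr₀₁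
  have hr₁0 : 0 < r₁ := hR.trans hr₁
  set b := m r₁ * r₁ ^ α with hb
  have hb0 : 0 < b := mul_pos (hm _ hr₁) (Real.rpow_pos_of_pos hr₁0 _)
  have hα2 : -α * (1 + 2 / α) = -α - 2 := by field_simp; ring
  have hp : 0 ≤ 1 + 2 / α := by positivity
  obtain ⟨ε, hε, hlow⟩ := H.exists_log_lower_bound h0 h1 hm hα hαn hr₁ (le_max_right _ _)
    (κ := c * b ^ (1 + 2 / α)) (by positivity) (fun r hr => by
      have hr0 : 0 < r := hr₁0.trans hr
      have hmr : b * r ^ (-α) ≤ m r := H.mul_rpow_mono hR h1 hm hf hα0 hαn hr₁ hr.le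
      calc c * b ^ (1 + 2 / α) * r ^ (-α - 2) = c * (b * r ^ (-α)) ^ (1 + 2 / α) := by
            rw [Real.mul_rpow hb0.le (by positivity), ← Real.rpow_mul hr0.le, hα2]; ring
        _ ≤ c * m r ^ (1 + 2 / α) := by gcongr
        _ ≤ f (m r) := hfα _ (hm r (hr₁.trans hr)) (hsmall r (hr₀₁.trans hr.le)))
  set q := (2 / 3 : ℝ) ^ α with hq
  have hq0 : 0 < q := by positivity
  have hq1 : q ≤ 1 := Real.rpow_le_one (by norm_num) (by norm_num) hα0.le
  have hbound : ∀ ρ, 2 * r₁ < ρ →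
      c * q ^ (1 + 2 / α) * (ε * log ρ) ^ (2 / α) ≤ 8 * (1 + n) := by
    intro ρ hρ
    have hρ0 : 0 < ρ := by linarith
    set M := m ρ with hM
    have hM0 : 0 < M := hm ρ (by linarith)
    obtain ⟨r, ⟨hr, hr'⟩, hfr⟩ := H.quadratic_test hn.le hR h0 h1 hm (ρ := ρ)
      (k := 4 * M / ρ ^ 2) (by linarith) (by positivity) (by rw [div_mul_cancel₀ _ (by positivity)])
    have hr0 : 0 < r := by linarith
    have hMr : q * M ≤ m r := by
      rcases le_total r ρ with h | h
      · have := hanti r ρ (by linarith) h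
        nlinarith
      · refine le_trans ?_ (H.mul_rpow_mono hR h1 hm hf hα0 hαn (by linarith) h)
        have : q ≤ ρ ^ α * r ^ (-α) := by
          rw [Real.rpow_neg hr0.le, ← div_eq_mul_inv, ← Real.div_rpow hρ0.le hr0.le]
          refine Real.rpow_le_rpow (by norm_num) ?_ hα0.le
          rw [le_div_iff₀ hr0]; linarith
        nlinarith
    have hupper : c * (q * M) ^ (1 + 2 / α) ≤ 2 * (4 * M / ρ ^ 2) * (1 + n) :=
      calc c * (q * M) ^ (1 + 2 / α) ≤ c * m r ^ (1 + 2 / α) := by gcongr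
        _ ≤ f (m r) := hfα _ (hm r (by linarith)) (hsmall r (by linarith))
        _ ≤ _ := hfr
    rw [Real.mul_rpow hq0.le hM0.le, Real.rpow_add hM0, Real.rpow_one] at hupper
    have hlogρ : 0 ≤ log ρ := by
      refine Real.log_nonneg ?_
      linarith [le_max_right r₀ (exp 2), Real.add_one_le_exp (2 : ℝ)]
    have hMlow : (ε * log ρ) ^ (2 / α) ≤ M ^ (2 / α) * ρ ^ 2 := by
      have : (ε * (ρ ^ (-α) * log ρ)) ^ (2 / α) ≤ M ^ (2 / α) := by
        refine Real.rpow_le_rpow (by positivity) (hlow ρ (by linarith)) (by positivity)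
      have e : ε * (ρ ^ (-α) * log ρ) = ε * log ρ * ρ ^ (-α) := by ring
      rw [e, Real.mul_rpow (by positivity) (by positivity), ← Real.rpow_mul hρ0.le] at this
      have e' : -α * (2 / α) = -2 := by field_simp
      rw [e', Real.rpow_neg hρ0.le, ← div_eq_mul_inv, div_le_iff₀ (by positivity)] at this
      exact_mod_cast this
    have hdiv : c * q ^ (1 + 2 / α) * (M ^ (2 / α) * ρ ^ 2) ≤ 8 * (1 + n) := by
      have e : 2 * (4 * M / ρ ^ 2) * (1 + n) = 8 * (1 + n) * M / ρ ^ 2 := by ring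
      rw [e, le_div_iff₀ (by positivity)] at hupper
      refine le_of_mul_le_mul_right ?_ hM0
      linarith
    refine le_trans ?_ hdiv
    gcongr
  have htend : Tendsto (fun ρ => c * q ^ (1 + 2 / α) * (ε * log ρ) ^ (2 / α)) atTop atTop :=
    ((tendsto_rpow_atTop (by positivity)).comp
      (Real.tendsto_log_atTop.const_mul_atTop hε)).const_mul_atTop (by positivity)
  obtain ⟨ρ, hρ, hρ'⟩ :=
    ((htend.eventually_gt_atTop (8 * (1 + n))).and (eventually_gt_atTop (2 * r₁))).exists
  exact absurd (hbound ρ hρ') (not_le.2 hρ)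

end RadialSupersolution

open scoped MatrixOrder in
lemma Matrix.PosSemidef.trace_mul_nonneg {ι : Type*} [Fintype ι] {A B : Matrix ι ι ℝ}
    (hA : A.PosSemidef) (hB : B.PosSemidef) : 0 ≤ (A * B).trace := by
  classical
  obtain ⟨C, rfl⟩ := CStarAlgebra.nonneg_iff_eq_star_mul_self.mp hA.nonneg
  rw [Matrix.mul_assoc, Matrix.trace_mul_comm]
  exact (hB.mul_mul_conjTranspose_same C).trace_nonneg

lemma Matrix.IsSymm.posSemidef_of_nonneg {ι : Type*} [Fintype ι] {A : Matrix ι ι ℝ}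
    (hA : A.IsSymm) (h : ∀ ξ : ι → ℝ, 0 ≤ ξ ⬝ᵥ A *ᵥ ξ) : A.PosSemidef :=
  .of_dotProduct_mulVec_nonneg ((Matrix.conjTranspose_eq_transpose_of_trivial A).trans hA)
    (by simpa using h)

lemma dotProduct_vecMulVec_self_mulVec {ι : Type*} [Fintype ι] (ν ξ : ι → ℝ) :
    ξ ⬝ᵥ vecMulVec ν ν *ᵥ ξ = (ν ⬝ᵥ ξ) ^ 2 := by
  rw [vecMulVec_mulVec]
  simp [dotProduct_comm ξ ν]
  ring

lemma trace_mul_vecMulVec_self {ι : Type*} [Fintype ι] (A : Matrix ι ι ℝ) (ν : ι → ℝ) :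
    (A * vecMulVec ν ν).trace = ν ⬝ᵥ A *ᵥ ν := by
  rw [mul_vecMulVec, trace_vecMulVec, dotProduct_comm]

/-- A bound for `P⁺_{λ,1}(M)` when `M` dominates the quadratic form with eigenvalue `p` in the
direction of the unit vector `ν` and `q` in the orthogonal directions. -/
lemma pucciMax_le {N : ℕ} (hN : 3 ≤ N) {lam : ℝ} (h0 : 0 < lam) (h1 : lam < 1)
    {M : Matrix (Fin N) (Fin N) ℝ} (hM : M.IsSymm) {ν : Fin N → ℝ} (hν : ν ⬝ᵥ ν = 1) {p q : ℝ}
    (h : ∀ ξ : Fin N → ℝ, p * (ν ⬝ᵥ ξ) ^ 2 + q * (ξ ⬝ᵥ ξ - (ν ⬝ᵥ ξ) ^ 2) ≤ ξ ⬝ᵥ M *ᵥ ξ) :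
    pucciMax N lam 1 M ≤ pucciScalar lam p + ((N : ℝ) - 1) * pucciScalar lam q := by
  have hN' : (3 : ℝ) ≤ N := by exact_mod_cast hN
  have hsq : ∀ ξ : Fin N → ℝ, ∑ i, ξ i ^ 2 = ξ ⬝ᵥ ξ := fun ξ => by simp [dotProduct, sq]
  have hVsymm : (vecMulVec ν ν).IsSymm := by
    ext i j; simp [vecMulVec_apply, mul_comm]
  have hproj : (1 - vecMulVec ν ν).PosSemidef := by
    refine (Matrix.isSymm_one.sub hVsymm).posSemidef_of_nonneg fun ξ => ?_
    rw [sub_mulVec, dotProduct_sub, dotProduct_vecMulVec_self_mulVec, one_mulVec, sub_nonneg]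
    have := Finset.sum_mul_sq_le_sq_mul_sq Finset.univ ν ξ
    rwa [hsq, hsq, hν, one_mul] at this
  refine csSup_le ⟨_, 1, Matrix.isSymm_one, fun ξ => ?_, rfl⟩ ?_
  · rw [one_mulVec, hsq]
    have : 0 ≤ ξ ⬝ᵥ ξ := by rw [← hsq]; positivity
    constructor <;> nlinarith
  rintro _ ⟨A, hA, hAξ, rfl⟩
  simp_rw [hsq] at hAξ
  have hAl : (A - lam • 1).PosSemidef := by
    refine (hA.sub (Matrix.isSymm_one.smul lam)).posSemidef_of_nonneg fun ξ => ?_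
    simpa [sub_mulVec, smul_mulVec] using (hAξ ξ).1
  have hAu : (1 - A).PosSemidef := by
    refine (Matrix.isSymm_one.sub hA).posSemidef_of_nonneg fun ξ => ?_
    simpa [sub_mulVec] using (hAξ ξ).2
  have hAp : A.PosSemidef := hA.posSemidef_of_nonneg fun ξ =>
    le_trans (mul_nonneg h0.le (by rw [← hsq]; positivity)) (hAξ ξ).1
  have hMD : (M - (q • (1 : Matrix (Fin N) (Fin N) ℝ) + (p - q) • vecMulVec ν ν)).PosSemidef := by
    refine (hM.sub ((Matrix.isSymm_one.smul q).add (hVsymm.smul _))).posSemidef_of_nonneg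
      fun ξ => ?_
    simp only [sub_mulVec, add_mulVec, smul_mulVec, dotProduct_sub, dotProduct_add,
      dotProduct_smul, dotProduct_vecMulVec_self_mulVec, one_mulVec, smul_eq_mul]
    linarith [h ξ]
  have t1 := hAl.trace_mul_nonneg hproj
  have t2 := hAu.trace_mul_nonneg hproj
  have t3 := hAp.trace_mul_nonneg hMD
  simp only [Matrix.mul_sub, Matrix.sub_mul, Matrix.mul_add, Matrix.mul_one, Matrix.one_mul,
    Matrix.mul_smul, Matrix.smul_mul, trace_sub, trace_add, trace_smul, trace_one,
    trace_mul_vecMulVec_self, trace_vecMulVec, hν, smul_eq_mul, Fintype.card_fin] at t1 t2 t3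
  obtain ⟨a1, a2⟩ := hAξ ν
  rw [hν, mul_one] at a1 a2
  set a := ν ⬝ᵥ A *ᵥ ν
  have hd : 0 < (N : ℝ) - 1 := by linarith
  have b1 : lam ≤ (A.trace - a) / ((N : ℝ) - 1) := by
    rw [le_div_iff₀ hd]; linarith
  have b2 : (A.trace - a) / ((N : ℝ) - 1) ≤ 1 := by
    rw [div_le_one hd]; linarith
  have c1 := neg_mul_le_pucciScalar (t := p) a1 a2
  have c2 := mul_le_mul_of_nonneg_left (neg_mul_le_pucciScalar (t := q) b1 b2) hd.le
  have e : ((N : ℝ) - 1) * -((A.trace - a) / ((N : ℝ) - 1) * q) = -((A.trace - a) * q) := by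
    field_simp
  rw [e] at c2
  rw [trace_neg]
  linarith

/-- The second-order necessary condition at a local minimum. -/
lemma IsLocalMin.second_deriv_nonneg {g g' : ℝ → ℝ} {t₀ c : ℝ} (hmin : IsLocalMin g t₀)
    (hg : ∀ᶠ t in nhds t₀, HasDerivAt g (g' t) t) (hg' : HasDerivAt g' c t₀) : 0 ≤ c := by
  by_contra! hc
  have hd : deriv g =ᶠ[nhds t₀] g' := hg.mono fun t ht => ht.deriv
  have hdd : deriv (deriv g) t₀ = c := by rw [hd.deriv_eq, hg'.deriv]
  have hmax : IsLocalMax g t₀ := isLocalMax_of_deriv_deriv_neg (by rwa [hdd]) hmin.deriv_eq_zero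
    hg.self_of_nhds.continuousAt
  have hconst : g =ᶠ[nhds t₀] fun _ => g t₀ := by
    filter_upwards [hmin, hmax] with t h h' using le_antisymm h' h
  have : deriv (deriv g) t₀ = 0 := by
    rw [hconst.deriv.deriv_eq]; simp
  linarith

section Hessian

variable {N : ℕ} {u : EuclideanSpace ℝ (Fin N) → ℝ} {x : EuclideanSpace ℝ (Fin N)}

lemma hessianMatrix_isSymm (hu : ContDiffAt ℝ 2 u x) : (hessianMatrix N u x).IsSymm := by
  ext i j
  simpa [hessianMatrix, iteratedFDeriv_two_apply] using (hu.isSymmSndFDerivAt (by simp)).eq _ _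

lemma dotProduct_hessianMatrix_mulVec (v : EuclideanSpace ℝ (Fin N)) :
    v.ofLp ⬝ᵥ hessianMatrix N u x *ᵥ v.ofLp = fderiv ℝ (fderiv ℝ u) x v v := by
  have hv : v = ∑ i, v i • EuclideanSpace.basisFun (Fin N) ℝ i := by
    simpa using ((EuclideanSpace.basisFun (Fin N) ℝ).sum_repr v).symm
  conv_rhs => rw [hv]
  simp [hessianMatrix, iteratedFDeriv_two_apply, dotProduct, mulVec, Finset.mul_sum]
  rw [Finset.sum_comm]
  exact Finset.sum_congr rfl fun i _ => Finset.sum_congr rfl fun j _ => by ring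

lemma hasDerivAt_comp_line (hu : ContDiffAt ℝ 2 u x) (v : EuclideanSpace ℝ (Fin N)) :
    (∀ᶠ t in nhds (0 : ℝ),
      HasDerivAt (fun t : ℝ => u (x + t • v)) (fderiv ℝ u (x + t • v) v) t) ∧
    HasDerivAt (fun t : ℝ => fderiv ℝ u (x + t • v) v) (fderiv ℝ (fderiv ℝ u) x v v) 0 := by
  have hline : ∀ t : ℝ, HasDerivAt (fun t : ℝ => x + t • v) v t := fun t => by
    simpa using ((hasDerivAt_id t).smul_const v).const_add x
  have hcont : Tendsto (fun t : ℝ => x + t • v) (nhds 0) (nhds x) := by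
    simpa using (hline 0).continuousAt.tendsto
  constructor
  · have : ∀ᶠ y in nhds x, DifferentiableAt ℝ u y :=
      (hu.eventually (by simp)).mono fun y hy => hy.differentiableAt two_ne_zero
    filter_upwards [hcont.eventually this] with t ht
    exact ht.hasFDerivAt.comp_hasDerivAt t (hline t)
  · have hd : DifferentiableAt ℝ (fderiv ℝ u) x :=
      (hu.fderiv_right (m := 1) (by norm_num)).differentiableAt one_ne_zero
    have hd' : HasFDerivAt (fderiv ℝ u) (fderiv ℝ (fderiv ℝ u) x) (x + (0 : ℝ) • v) := by
      simpa using hd.hasFDerivAt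
    have hc : HasDerivAt (fun t : ℝ => fderiv ℝ u (x + t • v)) (fderiv ℝ (fderiv ℝ u) x v) 0 :=
      HasFDerivAt.comp_hasDerivAt (f := fun t : ℝ => x + t • v) 0 hd' (hline 0)
    simpa using hc.clm_apply (hasDerivAt_const 0 v)

lemma hasDerivAt_radial_line {φ φ₁ φ₂ : ℝ → ℝ} (h₁ : ∀ r, 0 < r → HasDerivAt φ (φ₁ r) r)
    (h₂ : ∀ r, 0 < r → HasDerivAt φ₁ (φ₂ r) r) (hx : x ≠ 0) (v : EuclideanSpace ℝ (Fin N)) :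
    (∀ᶠ t in nhds (0 : ℝ), HasDerivAt (fun t : ℝ => φ ‖x + t • v‖)
      (φ₁ ‖x + t • v‖ * ((⟪x, v⟫ + t * ‖v‖ ^ 2) / ‖x + t • v‖)) t) ∧
    HasDerivAt (fun t : ℝ => φ₁ ‖x + t • v‖ * ((⟪x, v⟫ + t * ‖v‖ ^ 2) / ‖x + t • v‖))
      (φ₂ ‖x‖ * (⟪x, v⟫ / ‖x‖) ^ 2 + φ₁ ‖x‖ / ‖x‖ * (‖v‖ ^ 2 - (⟪x, v⟫ / ‖x‖) ^ 2)) 0 := by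
  have hnorm : ∀ t : ℝ, x + t • v ≠ 0 → HasDerivAt (fun t : ℝ => ‖x + t • v‖)
      ((⟪x, v⟫ + t * ‖v‖ ^ 2) / ‖x + t • v‖) t := by
    intro t ht
    have hline : HasDerivAt (fun t : ℝ => x + t • v) v t := by
      simpa using ((hasDerivAt_id t).smul_const v).const_add x
    have hs := hline.norm_sq.sqrt (pow_ne_zero 2 (norm_ne_zero_iff.2 ht))
    simp only [Real.sqrt_sq (norm_nonneg _)] at hs
    refine hs.congr_deriv ?_
    rw [inner_add_left, real_inner_smul_left, real_inner_self_eq_norm_sq]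
    field_simp
  have hne : ∀ᶠ t in nhds (0 : ℝ), x + t • v ≠ 0 := by
    have : ContinuousAt (fun t : ℝ => x + t • v) 0 := by fun_prop
    exact this.eventually_ne (by simpa using hx)
  have hx0 : 0 < ‖x‖ := norm_pos_iff.2 hx
  constructor
  · filter_upwards [hne] with t ht
    exact (h₁ _ (norm_pos_iff.2 ht)).comp t (hnorm t ht)
  · have hn0 := hnorm 0 (by simpa using hx)
    have hlin : HasDerivAt (fun t : ℝ => ⟪x, v⟫ + t * ‖v‖ ^ 2) (‖v‖ ^ 2) 0 := by
      simpa using ((hasDerivAt_id (0 : ℝ)).mul_const (‖v‖ ^ 2)).const_add ⟪x, v⟫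
    have hφ : HasDerivAt (fun t : ℝ => φ₁ ‖x + t • v‖) _ 0 :=
      (h₂ ‖x + (0 : ℝ) • v‖ (by simpa using hx0)).comp 0 hn0
    refine (hφ.mul (hlin.div hn0 (by simpa using hx))).congr_deriv ?_
    simp
    field_simp

/-- If `u - φ(‖·‖)` has a local minimum at `x`, then `P⁺_{λ,1}(D²u(x))` is at most the radial
form of the operator evaluated at `φ`. -/
lemma pucciMax_hessianMatrix_le (hN : 3 ≤ N) {lam : ℝ} (h0 : 0 < lam) (h1 : lam < 1)
    (hu : ContDiffAt ℝ 2 u x) (hx : x ≠ 0) {φ φ₁ φ₂ : ℝ → ℝ}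
    (h₁ : ∀ r, 0 < r → HasDerivAt φ (φ₁ r) r) (h₂ : ∀ r, 0 < r → HasDerivAt φ₁ (φ₂ r) r)
    (hmin : IsLocalMin (fun y => u y - φ ‖y‖) x) :
    pucciMax N lam 1 (hessianMatrix N u x) ≤
      pucciScalar lam (φ₂ ‖x‖) + ((N : ℝ) - 1) * pucciScalar lam (φ₁ ‖x‖ / ‖x‖) := by
  have hx0 : 0 < ‖x‖ := norm_pos_iff.2 hx
  have hdot : ∀ y z : EuclideanSpace ℝ (Fin N), y.ofLp ⬝ᵥ z.ofLp = ⟪y, z⟫ := fun y z => by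
    simp [PiLp.inner_apply, dotProduct, mul_comm]
  refine pucciMax_le hN h0 h1 (hessianMatrix_isSymm hu) (ν := (‖x‖⁻¹ • x).ofLp) ?_ fun ξ => ?_
  · rw [hdot, real_inner_self_eq_norm_sq, norm_smul, norm_inv, norm_norm,
      inv_mul_cancel₀ hx0.ne', one_pow]
  obtain ⟨v, rfl⟩ : ∃ v : EuclideanSpace ℝ (Fin N), v.ofLp = ξ := ⟨WithLp.toLp 2 ξ, rfl⟩
  rw [dotProduct_hessianMatrix_mulVec, hdot, hdot, real_inner_self_eq_norm_sq,
    real_inner_smul_left, inv_mul_eq_div]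
  obtain ⟨u1, u2⟩ := hasDerivAt_comp_line hu v
  obtain ⟨r1, r2⟩ := hasDerivAt_radial_line h₁ h₂ hx v
  have hloc : IsLocalMin (fun t : ℝ => u (x + t • v) - φ ‖x + t • v‖) 0 := by
    have hcont : Tendsto (fun t : ℝ => x + t • v) (nhds 0) (nhds x) := by
      have : ContinuousAt (fun t : ℝ => x + t • v) 0 := by fun_prop
      simpa using this.tendsto
    simpa [IsLocalMin, IsMinFilter] using hcont.eventually hmin
  have := hloc.second_deriv_nonneg ((u1.and r1).mono fun t ht => ht.1.sub ht.2) (u2.sub r2)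
  linarith

/-- Spherical minima of a supersolution form a radial supersolution. -/
lemma radialSupersolution_of_pucci (hN : 3 ≤ N) {lam R : ℝ} (h0 : 0 < lam) (h1 : lam < 1)
    (hR : 0 < R) {f : ℝ → ℝ}
    (hu : ContDiffOn ℝ 2 u {x : EuclideanSpace ℝ (Fin N) | R < ‖x‖})
    (hP : ∀ x : EuclideanSpace ℝ (Fin N), R < ‖x‖ →
      f (u x) ≤ pucciMax N lam 1 (hessianMatrix N u x)) {m : ℝ → ℝ}
    (hm : ∀ x : EuclideanSpace ℝ (Fin N), R < ‖x‖ → m ‖x‖ ≤ u x)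
    (hm' : ∀ r, R < r → ∃ x : EuclideanSpace ℝ (Fin N), ‖x‖ = r ∧ u x = m r) :
    RadialSupersolution ((N : ℝ) - 1) lam R f m := by
  intro a b ha hab φ φ₁ φ₂ h₁ h₂
  set S := {x : EuclideanSpace ℝ (Fin N) | a ≤ ‖x‖ ∧ ‖x‖ ≤ b}
  have hS : IsCompact S := by
    refine (isCompact_closedBall (0 : EuclideanSpace ℝ (Fin N)) b).of_isClosed_subset ?_ ?_
    · exact (isClosed_le continuous_const continuous_norm).inter
        (isClosed_le continuous_norm continuous_const)
    · intro x hx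
      simpa using hx.2
  have hcont : ContinuousOn (fun y => u y - φ ‖y‖) S := by
    refine (hu.continuousOn.mono fun x hx => ha.trans_le hx.1).sub fun x hx => ?_
    exact ((h₁ ‖x‖ (hR.trans (ha.trans_le hx.1))).continuousAt.comp
      continuous_norm.continuousAt).continuousWithinAt
  obtain ⟨y, hy, _⟩ := hm' a ha
  obtain ⟨x, hx, hmin⟩ := hS.exists_isMinOn ⟨y, by simp [S, hy, hab.le]⟩ hcont
  have hxR : R < ‖x‖ := ha.trans_le hx.1
  have hle : ∀ s ∈ Set.Icc a b, u x - φ ‖x‖ ≤ m s - φ s := by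
    rintro s ⟨has, hsb⟩
    obtain ⟨z, rfl, hz⟩ := hm' s (ha.trans_le has)
    rw [← hz]
    exact hmin ⟨has, hsb⟩
  have hmx : m ‖x‖ = u x := le_antisymm (hm x hxR) (by linarith [hle ‖x‖ hx])
  refine ⟨‖x‖, hx, by rwa [hmx], fun hax hxb => ?_⟩
  rw [hmx]
  have hopen : IsOpen {x : EuclideanSpace ℝ (Fin N) | R < ‖x‖} :=
    isOpen_lt continuous_const continuous_norm
  refine (hP x hxR).trans (pucciMax_hessianMatrix_le hN h0 h1
    (hu.contDiffAt (hopen.mem_nhds hxR)) (norm_pos_iff.1 (hR.trans hxR)) h₁ h₂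
    (hmin.isLocalMin ?_))
  filter_upwards [(isOpen_lt continuous_const continuous_norm).mem_nhds hax,
    (isOpen_lt continuous_norm continuous_const).mem_nhds hxb] with z hz hz'
  exact ⟨le_of_lt hz, le_of_lt hz'⟩

end Hessian

lemma exists_pos_mul_rpow_le_of_liminf_pos {f : ℝ → ℝ} {p : ℝ}
    (h : 0 < Filter.liminf (fun t : ℝ => t ^ (-p) * f t) (nhdsWithin 0 (Set.Ioi 0))) :
    ∃ c δ, 0 < c ∧ 0 < δ ∧ ∀ t, 0 < t → t < δ → c * t ^ p ≤ f t := by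
  rw [Filter.liminf_eq] at h
  obtain ⟨c, hc, hc0⟩ : ∃ c ∈ {a | ∀ᶠ t in nhdsWithin (0 : ℝ) (Set.Ioi 0), a ≤ t ^ (-p) * f t},
      0 < c := by
    by_contra! hcon
    exact absurd (Real.sSup_nonpos hcon) (not_le.2 h)
  obtain ⟨δ, hδ, hsub⟩ := mem_nhdsGT_iff_exists_Ioo_subset.1 hc
  refine ⟨c, δ, hc0, hδ, fun t ht htδ => ?_⟩
  have : c ≤ t ^ (-p) * f t := hsub ⟨ht, htδ⟩
  rwa [Real.rpow_neg ht.le, inv_mul_eq_div, le_div_iff₀ (Real.rpow_pos_of_pos ht _)] at this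

/-- If `N ≥ 3`, `1/(N-1) < λ < 1`, `λ* = (N-1+λ)/(N-1-λ)`, and `f : (0,∞) → (0,∞)` is
continuous with `liminf_{t→0⁺} t^{-λ*} f(t) > 0`, then for every `R > 0` there is no positive
`C²` function `u` on the exterior domain `{‖x‖ > R}` with `P⁺_{λ,1}(D²u) ≥ f(u)` there. -/
theorem liouville_pucci_good_ellipticity (N : ℕ) (hN : 3 ≤ N) (lam : ℝ)
    (hlam_lb : 1 / ((N : ℝ) - 1) < lam) (hlam_ub : lam < 1) (f : ℝ → ℝ)
    (hf_cont : ContinuousOn f (Set.Ioi 0)) (hf_pos : ∀ t : ℝ, 0 < t → 0 < f t)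
    (hf_liminf :
      0 < Filter.liminf
        (fun t : ℝ => t ^ (-(((N : ℝ) - 1 + lam) / ((N : ℝ) - 1 - lam))) * f t)
        (nhdsWithin 0 (Set.Ioi 0)))
    (R : ℝ) (hR : 0 < R) :
    ¬ ∃ u : EuclideanSpace ℝ (Fin N) → ℝ,
      (∀ x : EuclideanSpace ℝ (Fin N), R < ‖x‖ → 0 < u x) ∧
      ContDiffOn ℝ 2 u {x : EuclideanSpace ℝ (Fin N) | R < ‖x‖} ∧
      (∀ x : EuclideanSpace ℝ (Fin N), R < ‖x‖ →
        pucciMax N lam 1 (hessianMatrix N u x) ≥ f (u x)) := by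
  rintro ⟨u, hu_pos, hu, hP⟩
  have hN' : (3 : ℝ) ≤ N := by exact_mod_cast hN
  have h0 : 0 < lam := lt_trans (by apply one_div_pos.2; linarith) hlam_lb
  have hnl : 1 < ((N : ℝ) - 1) * lam := by
    rwa [div_lt_iff₀ (by linarith), mul_comm] at hlam_lb
  set α := ((N : ℝ) - 1) / lam - 1 with hα_def
  have hαn : lam * (α + 1) = (N : ℝ) - 1 := by rw [hα_def]; field_simp; ring
  have hα : 1 < α := by
    have : 2 < ((N : ℝ) - 1) / lam := by rw [lt_div_iff₀ h0]; linarith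
    linarith
  have hα0 : α ≠ 0 := by positivity
  have hexp : ((N : ℝ) - 1 + lam) / ((N : ℝ) - 1 - lam) = 1 + 2 / α := by
    rw [← hαn, show lam * (α + 1) - lam = lam * α by ring]
    clear_value α
    field_simp
    ring
  rw [hexp] at hf_liminf
  obtain ⟨c, δ, hc, hδ, hfα⟩ := exists_pos_mul_rpow_le_of_liminf_pos hf_liminf
  have : Nontrivial (EuclideanSpace ℝ (Fin N)) := by
    have : Nonempty (Fin N) := ⟨⟨0, by omega⟩⟩
    infer_instance
  have hex : ∀ r, ∃ t, R < r → (∃ x : EuclideanSpace ℝ (Fin N), ‖x‖ = r ∧ u x = t) ∧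
      ∀ x : EuclideanSpace ℝ (Fin N), ‖x‖ = r → t ≤ u x := by
    intro r
    by_cases hr : R < r
    · obtain ⟨x, hx, hmin⟩ := (isCompact_sphere (0 : EuclideanSpace ℝ (Fin N)) r).exists_isMinOn
        (NormedSpace.sphere_nonempty.2 (hR.trans hr).le)
        (hu.continuousOn.mono fun y hy => by
          rw [mem_sphere_zero_iff_norm] at hy
          exact hr.trans_eq hy.symm)
      exact ⟨u x, fun _ => ⟨⟨x, by simpa using hx, rfl⟩, fun y hy => hmin (by simpa using hy)⟩⟩
    · exact ⟨0, fun h => absurd h hr⟩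
  choose m hm using hex
  have H := radialSupersolution_of_pucci hN h0 hlam_ub hR hu hP
    (fun x hx => (hm ‖x‖ hx).2 x rfl) (fun r hr => (hm r hr).1)
  refine H.false_of_critical hR h0 hlam_ub hnl (fun r hr => ?_) hf_pos hf_cont hα hαn hc hδ hfα
  obtain ⟨x, hx, hux⟩ := (hm r hr).1
  exact hux ▸ hu_pos x (hx ▸ hr)
end
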